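/- Let Σ be a complete connected translating graph in a direction v_θ = sin θ·e₃ + cos θ·e₂ (θ ∈ [0,π)), contained in the slab {(x,y,z) : |x| ≤ w}, w > 0, and for t ∈ ℝ let μ(t) denote the number of connected components of Σ ∩ {y ≥ t}. Then μ is non-decreasing: if t ≤ t′ then μ(t) ≤ μ(t′). -/

import Mathlib

open MeasureTheory Metric Real EuclideanSpace
open scoped RealInnerProductSpace ENNReal NNReal

noncomputable section

abbrev E3 : Type := EuclideanSpace ℝ (Fin 3)

def e1 : E3 := EuclideanSpace.single 0 1
def e2 : E3 := EuclideanSpace.single 1 1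
def e3 : E3 := EuclideanSpace.single 2 1

/-- First partial derivative of `u` in the first variable. -/
def pds (u : ℝ × ℝ → ℝ) (p : ℝ × ℝ) : ℝ := fderiv ℝ u p (1, 0)

/-- First partial derivative of `u` in the second variable. -/
def pdt (u : ℝ × ℝ → ℝ) (p : ℝ × ℝ) : ℝ := fderiv ℝ u p (0, 1)

/-- `S` is a translating graph in the direction of the unit vector `v`, with respect to the
orthonormal basis `(a, b, v)` of `ℝ³`, over the open connected domain `Ω ⊆ ℝ²`, given by the
smooth function `u : Ω → ℝ` solving the translator equation. -/
structure IsTranslatingGraph (a b v : E3) (Ω : Set (ℝ × ℝ)) (u : ℝ × ℝ → ℝ)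
    (S : Set E3) : Prop where
  norm_a : ‖a‖ = 1
  norm_b : ‖b‖ = 1
  norm_v : ‖v‖ = 1
  inner_ab : ⟪a, b⟫ = 0
  inner_av : ⟪a, v⟫ = 0
  inner_bv : ⟪b, v⟫ = 0
  isOpen_dom : IsOpen Ω
  isConnected_dom : IsConnected Ω
  smooth : ContDiffOn ℝ (⊤ : ℕ∞) u Ω
  pde : ∀ p ∈ Ω,
    (1 + (pdt u p) ^ 2) * pds (fun q => pds u q) p
      - 2 * pds u p * pdt u p * pdt (fun q => pds u q) p
      + (1 + (pds u p) ^ 2) * pdt (fun q => pdt u q) p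
    = (1 + (pds u p) ^ 2 + (pdt u p) ^ 2) *
        (⟪e3, v⟫ - pds u p * ⟪e3, a⟫ - pdt u p * ⟪e3, b⟫)
  graph_eq : S = {q : E3 | ∃ p ∈ Ω, q = p.1 • a + p.2 • b + u p • v}

/-- Entropy of a surface. -/
def entropy (S : Set E3) : ℝ≥0∞ :=
  ⨆ (x₀ : E3) (s₀ : ℝ) (_ : 0 < s₀),
    (ENNReal.ofReal (4 * π * s₀))⁻¹ *
      ∫⁻ q in S, ENNReal.ofReal (Real.exp (-‖q - x₀‖ ^ 2 / (4 * s₀))) ∂(μH[2])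

/-- Number of connected components (as a cardinal). -/
def numComponents (A : Set E3) : Cardinal := Cardinal.mk (ConnectedComponents A)

def vθ (θ : ℝ) : E3 := Real.sin θ • e3 + Real.cos θ • e2
def bθ (θ : ℝ) : E3 := Real.cos θ • e3 - Real.sin θ • e2


/-- The point of the translating graph over parameter `p`, for the basis `(e₁, b_θ, v_θ)`. -/
def graphPtθ (θ : ℝ) (u : ℝ × ℝ → ℝ) (p : ℝ × ℝ) : E3 :=
  p.1 • e1 + p.2 • bθ θ + u p • vθ θ

/-- The Gauss map of a translating graph in the direction `v_θ`, as a function of the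
parameter `p ∈ Ω`: `N = (v_θ − u_s e₁ − u_t b_θ)/√(1+u_s²+u_t²)`. -/
def gaussMapθ (θ : ℝ) (u : ℝ × ℝ → ℝ) (p : ℝ × ℝ) : E3 :=
  (Real.sqrt (1 + (pds u p) ^ 2 + (pdt u p) ^ 2))⁻¹ •
    (vθ θ - pds u p • e1 - pdt u p • bθ θ)

open Filter Topology

/-! ### Directional derivatives of smooth functions on an open planar domain -/

/-- Directional derivative of `h` along `v`. -/
def dirD (v : ℝ × ℝ) (h : ℝ × ℝ → ℝ) (x : ℝ × ℝ) : ℝ := fderiv ℝ h x v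

lemma pds_eq_dirD (h : ℝ × ℝ → ℝ) : pds h = dirD (1, 0) h := rfl

lemma pdt_eq_dirD (h : ℝ × ℝ → ℝ) : pdt h = dirD (0, 1) h := rfl

lemma dirD_eq (v : ℝ × ℝ) (h : ℝ × ℝ → ℝ) (x : ℝ × ℝ) :
    dirD v h x = v.1 * pds h x + v.2 * pdt h x := by
  have : v = v.1 • ((1 : ℝ), (0 : ℝ)) + v.2 • ((0 : ℝ), (1 : ℝ)) := by ext <;> simp
  unfold dirD pds pdt
  conv_lhs => rw [this]
  simp only [map_add, map_smul, smul_eq_mul]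

lemma HasFDerivAt.dirD_eq {h : ℝ × ℝ → ℝ} {h' : ℝ × ℝ →L[ℝ] ℝ} {x : ℝ × ℝ}
    (H : HasFDerivAt h h' x) (v : ℝ × ℝ) : dirD v h x = h' v := by
  rw [dirD, H.fderiv]

lemma Filter.EventuallyEq.dirD {f g : ℝ × ℝ → ℝ} {x : ℝ × ℝ} (H : f =ᶠ[𝓝 x] g) (v : ℝ × ℝ) :
    dirD v f =ᶠ[𝓝 x] dirD v g := by
  filter_upwards [H.fderiv (𝕜 := ℝ)] with y hy
  simp only [_root_.dirD, hy]

lemma dirD_congr {f g : ℝ × ℝ → ℝ} {x : ℝ × ℝ} (H : f =ᶠ[𝓝 x] g) (v : ℝ × ℝ) :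
    dirD v f x = dirD v g x := (H.dirD v).eq_of_nhds

lemma two_le_smooth : (2 : WithTop ℕ∞) ≤ ((⊤ : ℕ∞) : WithTop ℕ∞) :=
  WithTop.coe_le_coe.2 le_top

section Smooth

variable {Ω : Set (ℝ × ℝ)} {f g h : ℝ × ℝ → ℝ} {x : ℝ × ℝ}

lemma smooth_dirD (hΩ : IsOpen Ω) (hh : ContDiffOn ℝ (⊤ : ℕ∞) h Ω) (v : ℝ × ℝ) :
    ContDiffOn ℝ (⊤ : ℕ∞) (dirD v h) Ω :=
  (hh.fderiv_of_isOpen hΩ (by simp)).clm_apply contDiffOn_const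

lemma smooth_hasFDerivAt (hΩ : IsOpen Ω) (hh : ContDiffOn ℝ (⊤ : ℕ∞) h Ω) (hx : x ∈ Ω) :
    HasFDerivAt h (fderiv ℝ h x) x :=
  ((hh.contDiffAt (hΩ.mem_nhds hx)).differentiableAt (by simp)).hasFDerivAt

lemma dirD_add (hΩ : IsOpen Ω) (hf : ContDiffOn ℝ (⊤ : ℕ∞) f Ω)
    (hg : ContDiffOn ℝ (⊤ : ℕ∞) g Ω) (hx : x ∈ Ω) (v : ℝ × ℝ) :
    dirD v (fun y => f y + g y) x = dirD v f x + dirD v g x := by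
  rw [((smooth_hasFDerivAt hΩ hf hx).fun_add (smooth_hasFDerivAt hΩ hg hx)).dirD_eq]; rfl

lemma dirD_mul (hΩ : IsOpen Ω) (hf : ContDiffOn ℝ (⊤ : ℕ∞) f Ω)
    (hg : ContDiffOn ℝ (⊤ : ℕ∞) g Ω) (hx : x ∈ Ω) (v : ℝ × ℝ) :
    dirD v (fun y => f y * g y) x = f x * dirD v g x + g x * dirD v f x := by
  rw [((smooth_hasFDerivAt hΩ hf hx).fun_mul (smooth_hasFDerivAt hΩ hg hx)).dirD_eq]; rfl

lemma dirD_const_mul (hΩ : IsOpen Ω) (hf : ContDiffOn ℝ (⊤ : ℕ∞) f Ω) (hx : x ∈ Ω) (a : ℝ)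
    (v : ℝ × ℝ) : dirD v (fun y => a * f y) x = a * dirD v f x := by
  rw [((smooth_hasFDerivAt hΩ hf hx).const_mul a).dirD_eq]; rfl

lemma dirD_const (a : ℝ) (v : ℝ × ℝ) : dirD v (fun _ => a) = fun _ => 0 := by
  ext x; simp [dirD]

lemma dirD_comm (hΩ : IsOpen Ω) (hh : ContDiffOn ℝ (⊤ : ℕ∞) h Ω) (hx : x ∈ Ω) (v w : ℝ × ℝ) :
    dirD v (dirD w h) x = dirD w (dirD v h) x := by
  have hc : ContDiffAt ℝ (⊤ : ℕ∞) h x := hh.contDiffAt (hΩ.mem_nhds hx)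
  have hd : DifferentiableAt ℝ (fderiv ℝ h) x :=
    ((hc.of_le two_le_smooth).fderiv_right (m := 1) (by norm_num)).differentiableAt (by simp)
  have key : ∀ a b : ℝ × ℝ, dirD a (dirD b h) x = fderiv ℝ (fderiv ℝ h) x a b := by
    intro a b
    have : HasFDerivAt (dirD b h) _ x := hd.hasFDerivAt.clm_apply (hasFDerivAt_const b x)
    rw [this.dirD_eq]; simp
  rw [key, key]
  exact ((hc.of_le two_le_smooth).isSymmSndFDerivAt (by simp)) v w

end Smooth

lemma isLocalMax_secondDeriv_nonpos {g g' : ℝ → ℝ} {g'' a : ℝ} (hmax : IsLocalMax g a)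
    (h1 : ∀ᶠ s in 𝓝 a, HasDerivAt g (g' s) s) (h2 : HasDerivAt g' g'' a) :
    g' a = 0 ∧ g'' ≤ 0 := by
  have hd : g' a = 0 := hmax.hasDerivAt_eq_zero h1.self_of_nhds
  refine ⟨hd, ?_⟩
  by_contra! hpos
  have e1 : deriv g =ᶠ[𝓝 a] g' := h1.mono fun s hs => hs.deriv
  have e2 : deriv (deriv g) a = g'' := by rw [e1.deriv_eq, h2.deriv]
  have hmin : IsLocalMin g a := isLocalMin_of_deriv_deriv_pos (by rw [e2]; exact hpos)
    (by rw [e1.eq_of_nhds, hd]) h1.self_of_nhds.continuousAt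
  have hconst : g =ᶠ[𝓝 a] fun _ => g a := by
    filter_upwards [hmax, hmin] with s hs1 hs2 using le_antisymm hs1 hs2
  have e3 : deriv (deriv g) a = 0 := by
    rw [hconst.deriv.deriv_eq]; simp
  linarith

lemma hasDerivAt_line {h : ℝ × ℝ → ℝ} {x v : ℝ × ℝ} {s : ℝ}
    (H : DifferentiableAt ℝ h (x + s • v)) :
    HasDerivAt (fun r : ℝ => h (x + r • v)) (dirD v h (x + s • v)) s := by
  have h1 : HasDerivAt (fun r : ℝ => x + r • v) v s := by
    simpa using ((hasDerivAt_id s).smul_const v).const_add x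
  exact H.hasFDerivAt.comp_hasDerivAt s h1

lemma tendsto_line (x v : ℝ × ℝ) : Tendsto (fun r : ℝ => x + r • v) (𝓝 0) (𝓝 x) := by
  have : Continuous fun r : ℝ => x + r • v := by fun_prop
  simpa using this.tendsto 0

lemma isLocalMax_dirD {h : ℝ × ℝ → ℝ} {x : ℝ × ℝ} (hh : ContDiffAt ℝ 2 h x)
    (hmax : IsLocalMax h x) (v : ℝ × ℝ) : dirD v h x = 0 ∧ dirD v (dirD v h) x ≤ 0 := by
  have hd : ∀ᶠ y in 𝓝 x, DifferentiableAt ℝ h y :=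
    (hh.eventually (by simp)).mono fun y hy => hy.differentiableAt (by simp)
  have hd2 : DifferentiableAt ℝ (dirD v h) x :=
    ((hh.fderiv_right (m := 1) (by norm_num)).differentiableAt (by simp)).clm_apply
      (differentiableAt_const v)
  have hm : IsLocalMax (fun r : ℝ => h (x + r • v)) 0 := by
    have := (tendsto_line x v).eventually hmax
    simpa [IsLocalMax, IsMaxFilter] using this
  have := isLocalMax_secondDeriv_nonpos (g' := fun r => dirD v h (x + r • v)) hm
    (((tendsto_line x v).eventually hd).mono fun s hs => hasDerivAt_line hs)
    (hasDerivAt_line (s := 0) (by simpa using hd2))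
  simpa using this

/-! ### Order of vanishing -/

/-- All partial derivatives of `h` of order less than `N` vanish at `x`. -/
def VanishesTo : ℕ → (ℝ × ℝ → ℝ) → ℝ × ℝ → Prop
  | 0, _, _ => True
  | N + 1, h, x => h x = 0 ∧ VanishesTo N (pds h) x ∧ VanishesTo N (pdt h) x

section Vanishing

variable {Ω : Set (ℝ × ℝ)} {f g h : ℝ × ℝ → ℝ} {x : ℝ × ℝ} {N : ℕ}

lemma smooth_pds (hΩ : IsOpen Ω) (hh : ContDiffOn ℝ (⊤ : ℕ∞) h Ω) :
    ContDiffOn ℝ (⊤ : ℕ∞) (pds h) Ω := smooth_dirD hΩ hh _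

lemma smooth_pdt (hΩ : IsOpen Ω) (hh : ContDiffOn ℝ (⊤ : ℕ∞) h Ω) :
    ContDiffOn ℝ (⊤ : ℕ∞) (pdt h) Ω := smooth_dirD hΩ hh _

lemma VanishesTo.of_succ : ∀ {N : ℕ} {h : ℝ × ℝ → ℝ},
    VanishesTo (N + 1) h x → VanishesTo N h x
  | 0, _, _ => trivial
  | _ + 1, _, H => ⟨H.1, H.2.1.of_succ, H.2.2.of_succ⟩

lemma VanishesTo.congr : ∀ {N : ℕ} {f g : ℝ × ℝ → ℝ},
    VanishesTo N f x → f =ᶠ[𝓝 x] g → VanishesTo N g x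
  | 0, _, _, _, _ => trivial
  | _ + 1, _, _, H, e => ⟨e.eq_of_nhds ▸ H.1, H.2.1.congr (e.dirD (1, 0)),
      H.2.2.congr (e.dirD (0, 1))⟩

lemma vanishesTo_zero : ∀ N : ℕ, VanishesTo N (fun _ => 0) x
  | 0 => trivial
  | N + 1 => by
    refine ⟨rfl, ?_, ?_⟩
    · rw [pds_eq_dirD, dirD_const]; exact vanishesTo_zero N
    · rw [pdt_eq_dirD, dirD_const]; exact vanishesTo_zero N

lemma eventuallyEq_of_eqOn (hΩ : IsOpen Ω) (hx : x ∈ Ω) (H : ∀ y ∈ Ω, f y = g y) :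
    f =ᶠ[𝓝 x] g := (hΩ.eventually_mem hx).mono H

lemma VanishesTo.add (hΩ : IsOpen Ω) (hx : x ∈ Ω) (hf : ContDiffOn ℝ (⊤ : ℕ∞) f Ω)
    (hg : ContDiffOn ℝ (⊤ : ℕ∞) g Ω) (Hf : VanishesTo N f x) (Hg : VanishesTo N g x) :
    VanishesTo N (fun y => f y + g y) x := by
  induction N generalizing f g with
  | zero => trivial
  | succ N ih =>
    refine ⟨by simp [Hf.1, Hg.1], ?_, ?_⟩
    · exact (ih (smooth_pds hΩ hf) (smooth_pds hΩ hg) Hf.2.1 Hg.2.1).congr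
        (eventuallyEq_of_eqOn hΩ hx fun y hy => (dirD_add hΩ hf hg hy _).symm)
    · exact (ih (smooth_pdt hΩ hf) (smooth_pdt hΩ hg) Hf.2.2 Hg.2.2).congr
        (eventuallyEq_of_eqOn hΩ hx fun y hy => (dirD_add hΩ hf hg hy _).symm)

lemma VanishesTo.mul (hΩ : IsOpen Ω) (hx : x ∈ Ω) (hf : ContDiffOn ℝ (⊤ : ℕ∞) f Ω)
    (hg : ContDiffOn ℝ (⊤ : ℕ∞) g Ω) (Hg : VanishesTo N g x) :
    VanishesTo N (fun y => f y * g y) x := by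
  induction N generalizing f g with
  | zero => trivial
  | succ N ih =>
    refine ⟨by simp [Hg.1], ?_, ?_⟩
    · exact ((ih hf (smooth_pds hΩ hg) Hg.2.1).add hΩ hx (hf.mul (smooth_pds hΩ hg))
        ((smooth_pds hΩ hf).mul hg) (ih (smooth_pds hΩ hf) hg Hg.of_succ)).congr
        (eventuallyEq_of_eqOn hΩ hx fun y hy => by
          rw [pds_eq_dirD, pds_eq_dirD, pds_eq_dirD, dirD_mul hΩ hf hg hy]; ring)
    · exact ((ih hf (smooth_pdt hΩ hg) Hg.2.2).add hΩ hx (hf.mul (smooth_pdt hΩ hg))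
        ((smooth_pdt hΩ hf).mul hg) (ih (smooth_pdt hΩ hf) hg Hg.of_succ)).congr
        (eventuallyEq_of_eqOn hΩ hx fun y hy => by
          rw [pdt_eq_dirD, pdt_eq_dirD, pdt_eq_dirD, dirD_mul hΩ hf hg hy]; ring)

lemma VanishesTo.const_mul (hΩ : IsOpen Ω) (hx : x ∈ Ω) (hg : ContDiffOn ℝ (⊤ : ℕ∞) g Ω)
    (Hg : VanishesTo N g x) (a : ℝ) : VanishesTo N (fun y => a * g y) x :=
  Hg.mul hΩ hx contDiffOn_const hg

lemma VanishesTo.mul_succ (hΩ : IsOpen Ω) (hx : x ∈ Ω) (hf : ContDiffOn ℝ (⊤ : ℕ∞) f Ω)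
    (hg : ContDiffOn ℝ (⊤ : ℕ∞) g Ω) (hf0 : f x = 0) (Hg : VanishesTo N g x) :
    VanishesTo (N + 1) (fun y => f y * g y) x := by
  induction N generalizing g with
  | zero => exact ⟨by simp [hf0], trivial, trivial⟩
  | succ N ih =>
    refine ⟨by simp [hf0], ?_, ?_⟩
    · exact ((ih (smooth_pds hΩ hg) Hg.2.1).add hΩ hx (hf.mul (smooth_pds hΩ hg))
        ((smooth_pds hΩ hf).mul hg) (Hg.mul hΩ hx (smooth_pds hΩ hf) hg)).congr
        (eventuallyEq_of_eqOn hΩ hx fun y hy => by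
          rw [pds_eq_dirD, pds_eq_dirD, pds_eq_dirD, dirD_mul hΩ hf hg hy]; ring)
    · exact ((ih (smooth_pdt hΩ hg) Hg.2.2).add hΩ hx (hf.mul (smooth_pdt hΩ hg))
        ((smooth_pdt hΩ hf).mul hg) (Hg.mul hΩ hx (smooth_pdt hΩ hf) hg)).congr
        (eventuallyEq_of_eqOn hΩ hx fun y hy => by
          rw [pdt_eq_dirD, pdt_eq_dirD, pdt_eq_dirD, dirD_mul hΩ hf hg hy]; ring)

lemma VanishesTo.dirD (hΩ : IsOpen Ω) (hx : x ∈ Ω) (hh : ContDiffOn ℝ (⊤ : ℕ∞) h Ω)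
    (H : VanishesTo (N + 1) h x) (v : ℝ × ℝ) : VanishesTo N (_root_.dirD v h) x := by
  have e : _root_.dirD v h = fun y => v.1 * pds h y + v.2 * pdt h y := funext (dirD_eq v h)
  rw [e]
  exact (H.2.1.const_mul hΩ hx (smooth_pds hΩ hh) _).add hΩ hx
    (contDiffOn_const.mul (smooth_pds hΩ hh)) (contDiffOn_const.mul (smooth_pdt hΩ hh))
    (H.2.2.const_mul hΩ hx (smooth_pdt hΩ hh) _)

lemma VanishesTo.of_mem_closure (hΩ : IsOpen Ω) (hx : x ∈ Ω) (hh : ContDiffOn ℝ (⊤ : ℕ∞) h Ω)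
    (H : x ∈ closure {y ∈ Ω | VanishesTo N h y}) : VanishesTo N h x := by
  induction N generalizing h with
  | zero => trivial
  | succ N ih =>
    have hs : {y ∈ Ω | VanishesTo (N + 1) h y} ⊆ {y ∈ Ω | VanishesTo N (pds h) y} :=
      fun y hy => ⟨hy.1, hy.2.2.1⟩
    have ht : {y ∈ Ω | VanishesTo (N + 1) h y} ⊆ {y ∈ Ω | VanishesTo N (pdt h) y} :=
      fun y hy => ⟨hy.1, hy.2.2.2⟩
    refine ⟨?_, ih (smooth_pds hΩ hh) (closure_mono hs H),
      ih (smooth_pdt hΩ hh) (closure_mono ht H)⟩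
    have hc : ContinuousAt h x := hh.continuousOn.continuousAt (hΩ.mem_nhds hx)
    have := hc.continuousWithinAt.mem_closure_image H
    have h0 : h '' {y ∈ Ω | VanishesTo (N + 1) h y} ⊆ {0} := by
      rintro _ ⟨y, hy, rfl⟩; exact hy.2.1
    simpa using closure_mono h0 this

lemma norm_fderiv_le_partials (h : ℝ × ℝ → ℝ) (x : ℝ × ℝ) :
    ‖fderiv ℝ h x‖ ≤ |pds h x| + |pdt h x| := by
  refine ContinuousLinearMap.opNorm_le_bound _ (by positivity) fun v => ?_
  have := dirD_eq v h x
  rw [dirD] at this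
  rw [this, Real.norm_eq_abs]
  have h1 : |v.1| ≤ ‖v‖ := norm_fst_le v
  have h2 : |v.2| ≤ ‖v‖ := norm_snd_le v
  calc |v.1 * pds h x + v.2 * pdt h x| ≤ |v.1| * |pds h x| + |v.2| * |pdt h x| := by
        rw [← abs_mul, ← abs_mul]; exact abs_add_le _ _
    _ ≤ ‖v‖ * |pds h x| + ‖v‖ * |pdt h x| := by gcongr
    _ = _ := by ring

/-- A function vanishing to order `N` at `x` is `O(‖y - x‖ ^ N)` near `x`. -/
lemma VanishesTo.bound (hΩ : IsOpen Ω) (hx : x ∈ Ω) (hh : ContDiffOn ℝ (⊤ : ℕ∞) h Ω)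
    (H : VanishesTo N h x) : ∃ C, 0 ≤ C ∧ ∀ᶠ y in 𝓝 x, |h y| ≤ C * ‖y - x‖ ^ N := by
  induction N generalizing h with
  | zero =>
    have hc : ContinuousAt h x := hh.continuousOn.continuousAt (hΩ.mem_nhds hx)
    refine ⟨|h x| + 1, by positivity, ?_⟩
    filter_upwards [hc.abs.eventually (gt_mem_nhds (lt_add_one |h x|))] with y hy
    simpa using hy.le
  | succ N ih =>
    obtain ⟨C₁, hC₁, H₁⟩ := ih (smooth_pds hΩ hh) H.2.1
    obtain ⟨C₂, hC₂, H₂⟩ := ih (smooth_pdt hΩ hh) H.2.2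
    refine ⟨C₁ + C₂, by positivity, ?_⟩
    obtain ⟨r, hr, hball⟩ := Metric.eventually_nhds_iff_ball.1
      (H₁.and (H₂.and (hΩ.eventually_mem hx)))
    filter_upwards [Metric.ball_mem_nhds x hr] with y hy
    have hsub : Metric.closedBall x ‖y - x‖ ⊆ Metric.ball x r :=
      Metric.closedBall_subset_ball (by simpa [dist_eq_norm] using hy)
    have := (convex_closedBall x ‖y - x‖).norm_image_sub_le_of_norm_fderiv_le (𝕜 := ℝ)
      (f := h) (C := (C₁ + C₂) * ‖y - x‖ ^ N) (x := x) (y := y)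
      (fun z hz => (smooth_hasFDerivAt hΩ hh (hball z (hsub hz)).2.2).differentiableAt)
      (fun z hz => by
        have hb := hball z (hsub hz)
        have hz' : ‖z - x‖ ≤ ‖y - x‖ := by simpa [dist_eq_norm] using hz
        calc ‖fderiv ℝ h z‖ ≤ |pds h z| + |pdt h z| := norm_fderiv_le_partials h z
          _ ≤ C₁ * ‖z - x‖ ^ N + C₂ * ‖z - x‖ ^ N := add_le_add hb.1 hb.2.1
          _ = (C₁ + C₂) * ‖z - x‖ ^ N := by ring
          _ ≤ _ := by gcongr)
      (by simp) (by simp [dist_eq_norm])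
    rw [H.1, sub_zero, Real.norm_eq_abs] at this
    rw [pow_succ, ← mul_assoc]; exact this

end Vanishing

/-! ### Leading jets of solutions of elliptic equations -/

/-- The complex number determining the leading jet (of order `m + 1`) of a function
which is harmonic to leading order with respect to `∂ₛ² + q² ∂ₜ²`. -/
def jetCoeff (q : ℝ) : ℕ → (ℝ × ℝ → ℝ) → ℝ × ℝ → ℂ
  | 0, h, x => pdt h x - Complex.I / q * pds h x
  | m + 1, h, x => jetCoeff q m (pdt h) x

/-- The Laplacian scaled by `q` in the second direction. -/
def scaledLap (q : ℝ) (h : ℝ × ℝ → ℝ) (y : ℝ × ℝ) : ℝ := pds (pds h) y + q ^ 2 * pdt (pdt h) y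

section Jets

variable {Ω : Set (ℝ × ℝ)} {f g h : ℝ × ℝ → ℝ} {x : ℝ × ℝ} {q : ℝ}

lemma jetCoeff_congr {m : ℕ} (H : f =ᶠ[𝓝 x] g) : jetCoeff q m f x = jetCoeff q m g x := by
  induction m generalizing f g with
  | zero =>
    simp only [jetCoeff, pds_eq_dirD, pdt_eq_dirD, dirD_congr H]
  | succ m ih => exact ih (H.dirD (0, 1))

lemma jetCoeff_linear (hΩ : IsOpen Ω) (hx : x ∈ Ω) (hf : ContDiffOn ℝ (⊤ : ℕ∞) f Ω)
    (hg : ContDiffOn ℝ (⊤ : ℕ∞) g Ω) (a b : ℝ) (m : ℕ) :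
    jetCoeff q m (fun y => a * f y + b * g y) x = a * jetCoeff q m f x + b * jetCoeff q m g x := by
  have key : ∀ {f g : ℝ × ℝ → ℝ}, ContDiffOn ℝ (⊤ : ℕ∞) f Ω → ContDiffOn ℝ (⊤ : ℕ∞) g Ω →
      ∀ v, ∀ y ∈ Ω, dirD v (fun y => a * f y + b * g y) y = a * dirD v f y + b * dirD v g y := by
    intro f g hf hg v y hy
    rw [dirD_add hΩ (contDiffOn_const.mul hf) (contDiffOn_const.mul hg) hy,
      dirD_const_mul hΩ hf hy, dirD_const_mul hΩ hg hy]
  induction m generalizing f g with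
  | zero =>
    simp only [jetCoeff, pds_eq_dirD, pdt_eq_dirD, key hf hg _ x hx]
    push_cast; ring
  | succ m ih =>
    simp only [jetCoeff]
    rw [← ih (smooth_pdt hΩ hf) (smooth_pdt hΩ hg)]
    exact jetCoeff_congr (eventuallyEq_of_eqOn hΩ hx fun y hy => key hf hg _ y hy)

lemma smooth_scaledLap (hΩ : IsOpen Ω) (hh : ContDiffOn ℝ (⊤ : ℕ∞) h Ω) :
    ContDiffOn ℝ (⊤ : ℕ∞) (scaledLap q h) Ω :=
  (smooth_pds hΩ (smooth_pds hΩ hh)).add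
    (contDiffOn_const.mul (smooth_pdt hΩ (smooth_pdt hΩ hh)))

lemma scaledLap_dirD (hΩ : IsOpen Ω) (hh : ContDiffOn ℝ (⊤ : ℕ∞) h Ω) (hx : x ∈ Ω)
    (v : ℝ × ℝ) : dirD v (scaledLap q h) x = scaledLap q (dirD v h) x := by
  have key : ∀ w, dirD v (dirD w (dirD w h)) x = dirD w (dirD w (dirD v h)) x := by
    intro w
    rw [dirD_comm hΩ (smooth_dirD hΩ hh w) hx]
    exact dirD_congr (eventuallyEq_of_eqOn hΩ hx fun y hy => dirD_comm hΩ hh hy v w) w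
  unfold scaledLap
  rw [dirD_add hΩ (smooth_pds hΩ (smooth_pds hΩ hh))
    (contDiffOn_const.mul (smooth_pdt hΩ (smooth_pdt hΩ hh))) hx,
    dirD_const_mul hΩ (smooth_pdt hΩ (smooth_pdt hΩ hh)) hx]
  simp only [pds_eq_dirD, pdt_eq_dirD, key]

lemma VanishesTo.scaledLap_dirD {N : ℕ} (hΩ : IsOpen Ω) (hx : x ∈ Ω)
    (hh : ContDiffOn ℝ (⊤ : ℕ∞) h Ω) (H : VanishesTo (N + 1) (scaledLap q h) x) (v : ℝ × ℝ) :
    VanishesTo N (scaledLap q (_root_.dirD v h)) x :=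
  (H.dirD hΩ hx (smooth_scaledLap hΩ hh) v).congr
    (eventuallyEq_of_eqOn hΩ hx fun _ hy => _root_.scaledLap_dirD hΩ hh hy v)

lemma jetCoeff_pds (hΩ : IsOpen Ω) (hx : x ∈ Ω) (hh : ContDiffOn ℝ (⊤ : ℕ∞) h Ω) (hq : q ≠ 0)
    {m : ℕ} (H : VanishesTo (m + 1) (scaledLap q h) x) :
    jetCoeff q m (pds h) x = Complex.I * q * jetCoeff q m (pdt h) x := by
  induction m generalizing h with
  | zero =>
    have h0 : (pds (pds h) x : ℂ) = - q ^ 2 * pdt (pdt h) x := by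
      have := H.1
      unfold scaledLap at this
      have : pds (pds h) x = - q ^ 2 * pdt (pdt h) x := by linarith
      rw [this]; push_cast; ring
    have h1 : pdt (pds h) x = pds (pdt h) x := dirD_comm hΩ hh hx _ _
    have hq' : (q : ℂ) ≠ 0 := by exact_mod_cast hq
    simp only [jetCoeff, h0, h1]
    field_simp
    linear_combination (pds (pdt h) x : ℂ) * Complex.I_sq
  | succ m ih =>
    simp only [jetCoeff]
    rw [← ih (smooth_pdt hΩ hh) (H.scaledLap_dirD hΩ hx hh _)]
    exact jetCoeff_congr (eventuallyEq_of_eqOn hΩ hx fun y hy => dirD_comm hΩ hh hy _ _)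

lemma dirD_iterate_eq_re (hΩ : IsOpen Ω) (hx : x ∈ Ω) (hh : ContDiffOn ℝ (⊤ : ℕ∞) h Ω)
    (hq : q ≠ 0) {m : ℕ} (H : VanishesTo m (scaledLap q h) x) (v : ℝ × ℝ) :
    ((dirD v)^[m + 1] h) x =
      (jetCoeff q m h x * ((v.2 : ℂ) + Complex.I * q * v.1) ^ (m + 1)).re := by
  induction m generalizing h with
  | zero =>
    have hq' : (q : ℂ) ≠ 0 := by exact_mod_cast hq
    have : jetCoeff q 0 h x * ((v.2 : ℂ) + Complex.I * q * v.1) ^ (0 + 1) =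
        ((v.1 * pds h x + v.2 * pdt h x : ℝ) : ℂ) +
          ((q * v.1 * pdt h x - v.2 * pds h x / q : ℝ) : ℂ) * Complex.I := by
      simp only [jetCoeff]
      push_cast
      field_simp
      linear_combination (-(q : ℂ) * v.1 * pds h x) * Complex.I_sq
    rw [this, Complex.add_re, Complex.ofReal_re, Complex.re_ofReal_mul, Complex.I_re, mul_zero,
      add_zero]
    exact dirD_eq v h x
  | succ m ih =>
    rw [Function.iterate_succ_apply, ih (smooth_dirD hΩ hh v) (H.scaledLap_dirD hΩ hx hh v)]
    congr 1
    have e : dirD v h = fun y => v.1 * pds h y + v.2 * pdt h y := funext (dirD_eq v h)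
    rw [e, jetCoeff_linear hΩ hx (smooth_pds hΩ hh) (smooth_pdt hΩ hh),
      jetCoeff_pds hΩ hx hh hq H]
    simp only [jetCoeff]
    ring

lemma VanishesTo.succ_of_jetCoeff (hΩ : IsOpen Ω) (hx : x ∈ Ω)
    (hh : ContDiffOn ℝ (⊤ : ℕ∞) h Ω) (hq : q ≠ 0) {m : ℕ} (H : VanishesTo m (scaledLap q h) x)
    (Hh : VanishesTo (m + 1) h x) (H0 : jetCoeff q m h x = 0) : VanishesTo (m + 2) h x := by
  induction m generalizing h with
  | zero =>
    have hq' : (q : ℂ) ≠ 0 := by exact_mod_cast hq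
    have e : ((q * pdt h x : ℝ) : ℂ) + ((-pds h x : ℝ) : ℂ) * Complex.I = 0 := by
      have : (q : ℂ) * jetCoeff q 0 h x = 0 := by rw [H0, mul_zero]
      rw [← this]; simp only [jetCoeff]; push_cast; field_simp; ring
    have e1 := congrArg Complex.re e
    have e2 := congrArg Complex.im e
    simp at e1 e2
    exact ⟨Hh.1, ⟨e2, trivial, trivial⟩, ⟨e1.resolve_left hq, trivial, trivial⟩⟩
  | succ m ih =>
    refine ⟨Hh.1, ?_, ?_⟩
    · refine ih (smooth_pds hΩ hh) (H.scaledLap_dirD hΩ hx hh _) Hh.2.1 ?_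
      rw [jetCoeff_pds hΩ hx hh hq H]
      simp only [jetCoeff] at H0
      rw [H0, mul_zero]
    · exact ih (smooth_pdt hΩ hh) (H.scaledLap_dirD hΩ hx hh _) Hh.2.2 H0

lemma eventually_pos_of_dirD_iterate (hΩ : IsOpen Ω) (hx : x ∈ Ω)
    (hh : ContDiffOn ℝ (⊤ : ℕ∞) h Ω) {m : ℕ} (Hh : VanishesTo m h x) {v : ℝ × ℝ}
    (H : 0 < ((dirD v)^[m] h) x) : ∀ᶠ s : ℝ in 𝓝[>] 0, 0 < h (x + s • v) := by
  induction m generalizing h with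
  | zero =>
    have hc : ContinuousAt h x := hh.continuousOn.continuousAt (hΩ.mem_nhds hx)
    exact ((tendsto_line x v).eventually (hc.eventually (lt_mem_nhds H))).filter_mono
      nhdsWithin_le_nhds
  | succ m ih =>
    have h1 := ih (smooth_dirD hΩ hh v) (Hh.dirD hΩ hx hh v) (by simpa using H)
    have h2 : ∀ᶠ s : ℝ in 𝓝 0, x + s • v ∈ Ω :=
      (tendsto_line x v).eventually (hΩ.eventually_mem hx)
    obtain ⟨δ, hδ, hs⟩ := mem_nhdsGT_iff_exists_Ioo_subset.1 h1
    obtain ⟨ε, hε, hball⟩ := Metric.eventually_nhds_iff.1 h2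
    have hd : ∀ s ∈ Set.Ico 0 (min δ ε), HasDerivAt (fun r : ℝ => h (x + r • v))
        (dirD v h (x + s • v)) s := fun s hs => hasDerivAt_line
      (smooth_hasFDerivAt hΩ hh (hball (by
        rw [Real.dist_eq, sub_zero, abs_of_nonneg hs.1]
        exact hs.2.trans_le (min_le_right _ _)))).differentiableAt
    have hmono : StrictMonoOn (fun r : ℝ => h (x + r • v)) (Set.Ico 0 (min δ ε)) := by
      refine strictMonoOn_of_deriv_pos (convex_Ico _ _)
        (fun s hs => (hd s hs).continuousAt.continuousWithinAt) fun s hs' => ?_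
      rw [interior_Ico] at hs'
      rw [(hd s ⟨hs'.1.le, hs'.2⟩).deriv]
      exact hs ⟨hs'.1, hs'.2.trans_le (min_le_left _ _)⟩
    have hm : 0 < min δ ε := lt_min hδ hε
    filter_upwards [Ioo_mem_nhdsGT hm] with s hs'
    have := hmono (Set.left_mem_Ico.2 hm) ⟨hs'.1.le, hs'.2⟩ hs'.1
    simpa [Hh.1] using this

/-- A solution of an elliptic equation without zeroth order term, which does not increase along
any segment issuing from a critical point, vanishes there to infinite order. -/
lemma vanishesTo_of_not_increasing (hΩ : IsOpen Ω) (hx : x ∈ Ω)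
    (hh : ContDiffOn ℝ (⊤ : ℕ∞) h Ω) (hq : q ≠ 0) {a b c d : ℝ × ℝ → ℝ}
    (ha : ContDiffOn ℝ (⊤ : ℕ∞) a Ω) (hb : ContDiffOn ℝ (⊤ : ℕ∞) b Ω)
    (hc : ContDiffOn ℝ (⊤ : ℕ∞) c Ω) (hd : ContDiffOn ℝ (⊤ : ℕ∞) d Ω)
    (hax : q ^ 2 * a x = 1) (hbx : b x = 0) (hcx : c x = 1)
    (hpde : ∀ y ∈ Ω, a y * pds (pds h) y + b y * pdt (pds h) y + c y * pdt (pdt h) y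
      + d y * pdt h y = 0)
    (h0 : h x = 0) (h1 : pds h x = 0) (h2 : pdt h x = 0)
    (hinc : ∀ v : ℝ × ℝ, ¬ ∀ᶠ s : ℝ in 𝓝[>] 0, 0 < h (x + s • v)) (N : ℕ) :
    VanishesTo N h x := by
  have hss := smooth_pds hΩ (smooth_pds hΩ hh)
  have hst := smooth_pdt hΩ (smooth_pds hΩ hh)
  have htt := smooth_pdt hΩ (smooth_pdt hΩ hh)
  have lap : ∀ m, VanishesTo (m + 2) h x → VanishesTo (m + 1) (scaledLap q h) x := by
    intro m hm
    have sa : ContDiffOn ℝ (⊤ : ℕ∞) (fun y => 1 - q ^ 2 * a y) Ω :=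
      contDiffOn_const.sub (contDiffOn_const.mul ha)
    have sb : ContDiffOn ℝ (⊤ : ℕ∞) (fun y => - q ^ 2 * b y) Ω := contDiffOn_const.mul hb
    have sc : ContDiffOn ℝ (⊤ : ℕ∞) (fun y => q ^ 2 * (1 - c y)) Ω :=
      contDiffOn_const.mul (contDiffOn_const.sub hc)
    have sd : ContDiffOn ℝ (⊤ : ℕ∞) (fun y => - q ^ 2 * d y) Ω := contDiffOn_const.mul hd
    have va := hm.2.1.2.1.mul_succ hΩ hx sa hss (by rw [hax, sub_self])
    have vb := hm.2.1.2.2.mul_succ hΩ hx sb hst (by rw [hbx, mul_zero])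
    have vc := hm.2.2.2.2.mul_succ hΩ hx sc htt (by rw [hcx, sub_self, mul_zero])
    have vd := hm.2.2.mul hΩ hx sd (smooth_pdt hΩ hh)
    refine (((va.add hΩ hx (sa.mul hss) (sb.mul hst) vb).add hΩ hx
      ((sa.mul hss).add (sb.mul hst)) (sc.mul htt) vc).add hΩ hx
      (((sa.mul hss).add (sb.mul hst)).add (sc.mul htt)) (sd.mul (smooth_pdt hΩ hh)) vd).congr
      (eventuallyEq_of_eqOn hΩ hx fun y hy => ?_)
    unfold scaledLap
    linear_combination (- q ^ 2) * hpde y hy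
  have step : ∀ m, VanishesTo (m + 2) h x := by
    intro m
    induction m with
    | zero => exact ⟨h0, ⟨h1, trivial, trivial⟩, ⟨h2, trivial, trivial⟩⟩
    | succ m ih =>
      have hl := lap m ih
      refine VanishesTo.succ_of_jetCoeff (m := m + 1) hΩ hx hh hq hl ih ?_
      by_contra hA
      obtain ⟨ζ, hζ⟩ := IsAlgClosed.exists_pow_nat_eq
        ((starRingEnd ℂ) (jetCoeff q (m + 1) h x)) (n := m + 1 + 1) (by omega)
      refine hinc (ζ.im / q, ζ.re) (eventually_pos_of_dirD_iterate hΩ hx hh ih ?_)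
      rw [dirD_iterate_eq_re hΩ hx hh hq hl]
      have hq' : (q : ℂ) ≠ 0 := by exact_mod_cast hq
      have e : ((ζ.re : ℝ) : ℂ) + Complex.I * q * ((ζ.im / q : ℝ) : ℂ) = ζ := by
        push_cast
        rw [mul_assoc, mul_div_cancel₀ _ hq', mul_comm]
        exact Complex.re_add_im ζ
      rw [e, hζ, Complex.mul_conj, Complex.ofReal_re]
      exact Complex.normSq_pos.2 hA
  exact (step N).of_succ.of_succ

end Jets

/-- The quadratic form `(1 + r²) a² - 2 p r a b + (1 + p²) b²`. -/
def graphQuad (p r a b : ℝ) : ℝ := (1 + r ^ 2) * a ^ 2 - 2 * p * r * (a * b) + (1 + p ^ 2) * b ^ 2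

/-- The bilinear form associated with `graphQuad`. -/
def graphBil (p r a b a' b' : ℝ) : ℝ :=
  (1 + r ^ 2) * (a * a') - p * r * (a * b' + b * a') + (1 + p ^ 2) * (b * b')

lemma graphQuad_nonneg (p r a b : ℝ) : 0 ≤ graphQuad p r a b := by
  unfold graphQuad; nlinarith [sq_nonneg a, sq_nonneg b, sq_nonneg (r * a - p * b)]

/-- The Bochner identity for `E = (1 + k²) p² + (k - r)²` on a translating graph with gradient
`(p, r)` and Hessian `(l, m, n)`. -/
lemma bochner_identity {p r l m n k c ω D E Es Et LE ωs ωt : ℝ}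
    (hω : ω = 1 + p ^ 2 + r ^ 2) (hD : D = l * n - m ^ 2)
    (hE : E = (1 + k ^ 2) * p ^ 2 + (k - r) ^ 2)
    (hEs : Es = 2 * (1 + k ^ 2) * p * l - 2 * (k - r) * m)
    (hEt : Et = 2 * (1 + k ^ 2) * p * m - 2 * (k - r) * n)
    (hωs : ωs = 2 * p * l + 2 * r * m) (hωt : ωt = 2 * p * m + 2 * r * n)
    (hLE : LE = 2 * (1 + k ^ 2) * (p * (ωs * (c * (k - r)) - 2 * p * D) + graphQuad p r l m)
      + 2 * (-(k - r) * (ωt * (c * (k - r)) - 2 * r * D) + graphQuad p r m n))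
    (hpde : (1 + r ^ 2) * l - 2 * p * r * m + (1 + p ^ 2) * n = ω * (c * (k - r)))
    (hk : 1 + k * r ≠ 0) :
    E * LE - graphQuad p r Es Et =
      E ^ 2 * (2 * (c * (k - r)) ^ 2 - 2 * D / ω + graphQuad p r ωs ωt / (2 * ω ^ 2))
      + 2 * (1 + k * r) ^ 2 * (c * (k - r)) ^ 2 * E
      - c * (k - r) / (1 + k * r) * (E + 2 * (1 + k * r) ^ 2) *
        (graphBil p r Es Et p (r - k) - E * graphBil p r ωs ωt p (r - k) / ω) := by
  have hr : (1 + r ^ 2) ≠ 0 := by positivity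
  have hω0 : ω ≠ 0 := by rw [hω]; positivity
  have hl : l = (ω * (c * (k - r)) + 2 * p * r * m - (1 + p ^ 2) * n) / (1 + r ^ 2) := by
    rw [eq_div_iff hr]; linarith
  have hω1 : 1 + p ^ 2 + r ^ 2 ≠ 0 := hω ▸ hω0
  unfold graphQuad graphBil at *
  subst hω hD hE hLE hωs hωt hEs hEt
  rw [hl]
  field_simp
  ring

lemma abs_graphBil_le {p r a b a' b' M : ℝ} (hp : |p| ≤ M) (hr : |r| ≤ M) :
    |graphBil p r a b a' b'| ≤ (1 + M ^ 2) * (|a| + |b|) * (|a'| + |b'|) := by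
  have hM : 0 ≤ M := (abs_nonneg p).trans hp
  have hp2 : p ^ 2 ≤ M ^ 2 := by rw [← sq_abs p]; gcongr
  have hr2 : r ^ 2 ≤ M ^ 2 := by rw [← sq_abs r]; gcongr
  have hpr : |p * r| ≤ 1 + M ^ 2 := by
    rw [abs_mul]; nlinarith [mul_le_mul hp hr (abs_nonneg r) hM]
  have e : graphBil p r a b a' b' = (1 + r ^ 2) * (a * a') + -(p * r) * (a * b')
      + -(p * r) * (b * a') + (1 + p ^ 2) * (b * b') := by unfold graphBil; ring
  have h1 : |(1 + r ^ 2) * (a * a')| ≤ (1 + M ^ 2) * (|a| * |a'|) := by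
    rw [abs_mul, abs_mul, abs_of_nonneg (by positivity : 0 ≤ 1 + r ^ 2)]; gcongr
  have h2 : |-(p * r) * (a * b')| ≤ (1 + M ^ 2) * (|a| * |b'|) := by
    rw [abs_mul, abs_neg, abs_mul a]; gcongr
  have h3 : |-(p * r) * (b * a')| ≤ (1 + M ^ 2) * (|b| * |a'|) := by
    rw [abs_mul, abs_neg, abs_mul b]; gcongr
  have h4 : |(1 + p ^ 2) * (b * b')| ≤ (1 + M ^ 2) * (|b| * |b'|) := by
    rw [abs_mul, abs_mul, abs_of_nonneg (by positivity : 0 ≤ 1 + p ^ 2)]; gcongr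
  rw [e]
  refine ((abs_add_le _ _).trans (add_le_add (abs_add_three _ _ _) le_rfl)).trans ?_
  linarith

lemma bochner_inequality {p r l m n k c ω D E Es Et LE ωs ωt M : ℝ}
    (hω : ω = 1 + p ^ 2 + r ^ 2) (hD : D = l * n - m ^ 2)
    (hE : E = (1 + k ^ 2) * p ^ 2 + (k - r) ^ 2)
    (hEs : Es = 2 * (1 + k ^ 2) * p * l - 2 * (k - r) * m)
    (hEt : Et = 2 * (1 + k ^ 2) * p * m - 2 * (k - r) * n)
    (hωs : ωs = 2 * p * l + 2 * r * m) (hωt : ωt = 2 * p * m + 2 * r * n)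
    (hLE : LE = 2 * (1 + k ^ 2) * (p * (ωs * (c * (k - r)) - 2 * p * D) + graphQuad p r l m)
      + 2 * (-(k - r) * (ωt * (c * (k - r)) - 2 * r * D) + graphQuad p r m n))
    (hpde : (1 + r ^ 2) * l - 2 * p * r * m + (1 + p ^ 2) * n = ω * (c * (k - r)))
    (hk : 1 + k * r ≠ 0) (hpM : |p| ≤ M) (hrM : |r| ≤ M) (hDM : |D| ≤ M)
    (hcM : |c / (1 + k * r)| ≤ M) (hEM : E + 2 * (1 + k * r) ^ 2 ≤ M)
    (hωM : |ωs| + |ωt| ≤ M) :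
    -((2 * M + 2 * M ^ 2 * (1 + M ^ 2) * (1 + M)) * (E ^ 2 + E * (|Es| + |Et|))) ≤
      E * LE - graphQuad p r Es Et := by
  rw [bochner_identity hω hD hE hEs hEt hωs hωt hLE hpde hk]
  have hM : 0 ≤ M := (abs_nonneg p).trans hpM
  have hω1 : 1 ≤ ω := by rw [hω]; nlinarith [sq_nonneg p, sq_nonneg r]
  have hE0 : 0 ≤ E := by rw [hE]; positivity
  have hkE : |k - r| * (|p| + |r - k|) ≤ 2 * E := by
    rw [abs_sub_comm r k]
    nlinarith [sq_nonneg (|k - r| - |p|), sq_abs p, sq_abs (k - r), sq_nonneg (k * p)]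
  have t1 : -(2 * M * E ^ 2) ≤
      E ^ 2 * (2 * (c * (k - r)) ^ 2 - 2 * D / ω + graphQuad p r ωs ωt / (2 * ω ^ 2)) := by
    have a1 : D / ω ≤ M := by
      rw [div_le_iff₀ (by linarith)]
      nlinarith [le_abs_self D]
    have a2 : 0 ≤ graphQuad p r ωs ωt / (2 * ω ^ 2) :=
      div_nonneg (graphQuad_nonneg _ _ _ _) (by positivity)
    have a3 : -(2 * M) ≤ 2 * (c * (k - r)) ^ 2 - 2 * D / ω + graphQuad p r ωs ωt / (2 * ω ^ 2) := by
      rw [mul_div_assoc]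
      linarith [sq_nonneg (c * (k - r))]
    linarith [mul_le_mul_of_nonneg_left a3 (sq_nonneg E)]
  have t2 : 0 ≤ 2 * (1 + k * r) ^ 2 * (c * (k - r)) ^ 2 * E := by positivity
  set G := graphBil p r Es Et p (r - k) - E * graphBil p r ωs ωt p (r - k) / ω with hG
  have t3 : |c * (k - r) / (1 + k * r) * (E + 2 * (1 + k * r) ^ 2) * G| ≤
      2 * M ^ 2 * (1 + M ^ 2) * (E * (|Es| + |Et|) + M * E ^ 2) := by
    have b1 : |k - r| * |graphBil p r Es Et p (r - k)| ≤
        (1 + M ^ 2) * (|Es| + |Et|) * (2 * E) := by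
      calc _ ≤ |k - r| * ((1 + M ^ 2) * (|Es| + |Et|) * (|p| + |r - k|)) := by
            gcongr; exact abs_graphBil_le hpM hrM
        _ = (1 + M ^ 2) * (|Es| + |Et|) * (|k - r| * (|p| + |r - k|)) := by ring
        _ ≤ _ := by gcongr
    have b2 : |k - r| * |graphBil p r ωs ωt p (r - k)| ≤ (1 + M ^ 2) * M * (2 * E) := by
      calc _ ≤ |k - r| * ((1 + M ^ 2) * (|ωs| + |ωt|) * (|p| + |r - k|)) := by
            gcongr; exact abs_graphBil_le hpM hrM
        _ = (1 + M ^ 2) * (|ωs| + |ωt|) * (|k - r| * (|p| + |r - k|)) := by ring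
        _ ≤ _ := by gcongr
    have b3 : |G| ≤ |graphBil p r Es Et p (r - k)| + E * |graphBil p r ωs ωt p (r - k)| := by
      refine (abs_sub _ _).trans (add_le_add le_rfl ?_)
      rw [abs_div, abs_mul, abs_of_nonneg hE0, abs_of_nonneg (by linarith : 0 ≤ ω)]
      exact div_le_self (by positivity) hω1
    have b4 : |k - r| * |G| ≤ (1 + M ^ 2) * (|Es| + |Et|) * (2 * E)
        + E * ((1 + M ^ 2) * M * (2 * E)) := by
      calc _ ≤ |k - r| * (|graphBil p r Es Et p (r - k)|
            + E * |graphBil p r ωs ωt p (r - k)|) := by gcongr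
        _ = |k - r| * |graphBil p r Es Et p (r - k)|
            + E * (|k - r| * |graphBil p r ωs ωt p (r - k)|) := by ring
        _ ≤ _ := by gcongr
    have hpos : 0 ≤ E + 2 * (1 + k * r) ^ 2 := by positivity
    calc _ = |c / (1 + k * r)| * (E + 2 * (1 + k * r) ^ 2) * (|k - r| * |G|) := by
          rw [abs_mul, abs_mul, abs_of_nonneg hpos, mul_div_right_comm, abs_mul]; ring
      _ ≤ M * M * ((1 + M ^ 2) * (|Es| + |Et|) * (2 * E)
        + E * ((1 + M ^ 2) * M * (2 * E))) := by gcongr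
      _ = _ := by ring
  have t4 := le_abs_self (c * (k - r) / (1 + k * r) * (E + 2 * (1 + k * r) ^ 2) * G)
  have t5 : 0 ≤ M * (E * (|Es| + |Et|)) := by positivity
  have t6 : 0 ≤ M ^ 2 * (1 + M ^ 2) * E ^ 2 := by positivity
  have t7 : 0 ≤ M ^ 2 * (1 + M ^ 2) * (M * (E * (|Es| + |Et|))) := by positivity
  linarith

/-- The Carleman-type weight `-log ρ + A ρ`, as a function of `R = ρ²`, is strictly subharmonic
near the origin for operators whose principal part is a perturbation of the Laplacian. -/
lemma radial_weight_inequality {p r d q k X T ρ B C : ℝ} (hρ : 0 < ρ)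
    (hR : ρ ^ 2 = q ^ 2 * X ^ 2 + T ^ 2) (hq : q ^ 2 * (1 + k ^ 2) = 1)
    (hp : |p| ≤ B * ρ) (hrk : |r - k| ≤ B * ρ) (hpB : |p| ≤ B) (hrB : |r| ≤ B) (hkB : |k| ≤ B)
    (hdB : |d| ≤ B) (hC : 0 ≤ C) {A φ₁ φ₂ : ℝ} (hA : A = 20 * B ^ 2 + 2 * B + 2 * C + 1)
    (hsmall : ρ * (1 + (20 * B ^ 2 + 2 * B + 2 * C) * A) ≤ 1)
    (hφ₁ : φ₁ = -1 / (2 * ρ ^ 2) + A / (2 * ρ)) (hφ₂ : φ₂ = 1 / (2 * ρ ^ 4) - A / (4 * ρ ^ 3)) :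
    1 ≤ φ₁ * ((1 + r ^ 2) * (2 * q ^ 2) + (1 + p ^ 2) * 2 + d * (2 * T))
      + φ₂ * graphQuad p r (2 * q ^ 2 * X) (2 * T)
      - C * (|φ₁ * (2 * q ^ 2 * X)| + |φ₁ * (2 * T)|) := by
  have hB : 0 ≤ B := (abs_nonneg p).trans hpB
  set C₀ := 20 * B ^ 2 + 2 * B with hC₀
  have hC₀0 : 0 ≤ C₀ := by positivity
  have hA0 : 0 ≤ A := by rw [hA]; positivity
  have hq1 : q ^ 2 ≤ 1 := by nlinarith [sq_nonneg (q * k), sq_nonneg q]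
  have hqX : |q ^ 2 * X| ≤ ρ := by
    apply abs_le_of_sq_le_sq _ hρ.le
    nlinarith [sq_nonneg T, mul_nonneg (sq_nonneg q) (sq_nonneg X)]
  have hT : |T| ≤ ρ := by
    apply abs_le_of_sq_le_sq _ hρ.le
    nlinarith [mul_nonneg (sq_nonneg q) (sq_nonneg X)]
  have hrk2 : |r ^ 2 - k ^ 2| ≤ 2 * B * (B * ρ) := by
    have : r ^ 2 - k ^ 2 = (r + k) * (r - k) := by ring
    rw [this, abs_mul]
    gcongr
    linarith [abs_add_le r k]
  have hp2 : |p ^ 2| ≤ B * (B * ρ) := by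
    rw [sq, abs_mul]; gcongr
  set e₁ := (1 + r ^ 2) * (2 * q ^ 2) + (1 + p ^ 2) * 2 + d * (2 * T) - 4 with he₁
  set e₂ := graphQuad p r (2 * q ^ 2 * X) (2 * T) - 4 * ρ ^ 2 with he₂
  have he₁' : |e₁| ≤ C₀ * ρ := by
    have : e₁ = 2 * (q ^ 2 * (r ^ 2 - k ^ 2)) + 2 * p ^ 2 + 2 * (d * T) := by
      rw [he₁]; linear_combination (2 : ℝ) * hq
    rw [this]
    have a1 : |q ^ 2 * (r ^ 2 - k ^ 2)| ≤ 1 * (2 * B * (B * ρ)) := by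
      rw [abs_mul, abs_of_nonneg (sq_nonneg q)]; gcongr
    have a2 : |d * T| ≤ B * ρ := by rw [abs_mul]; gcongr
    rw [abs_le] at a1 a2 hp2 ⊢
    have : 0 ≤ B ^ 2 * ρ := by positivity
    constructor <;> linarith
  have he₂' : |e₂| ≤ C₀ * ρ ^ 3 := by
    have : e₂ = 4 * ((q ^ 2 * X) ^ 2 * (r ^ 2 - k ^ 2)) - 8 * (p * r * (q ^ 2 * X * T))
        + 4 * (p ^ 2 * T ^ 2) := by
      rw [he₂, hR]; unfold graphQuad
      linear_combination (4 * q ^ 2 * X ^ 2) * hq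
    rw [this]
    have s1 : (q ^ 2 * X) ^ 2 ≤ ρ ^ 2 := by rw [← sq_abs (q ^ 2 * X)]; gcongr
    have s2 : T ^ 2 ≤ ρ ^ 2 := by rw [← sq_abs T]; gcongr
    have a1 : |(q ^ 2 * X) ^ 2 * (r ^ 2 - k ^ 2)| ≤ ρ ^ 2 * (2 * B * (B * ρ)) := by
      rw [abs_mul, abs_of_nonneg (sq_nonneg _)]; gcongr
    have a2 : |p * r * (q ^ 2 * X * T)| ≤ (B * ρ) * B * (ρ * ρ) := by
      rw [abs_mul, abs_mul p, abs_mul _ T]; gcongr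
    have a3 : |p ^ 2 * T ^ 2| ≤ B * (B * ρ) * ρ ^ 2 := by
      rw [abs_mul, abs_of_nonneg (sq_nonneg T)]; gcongr
    rw [abs_le] at a1 a2 a3 ⊢
    have h3 : 0 ≤ B * ρ ^ 3 := by positivity
    have e1 : ρ ^ 2 * (2 * B * (B * ρ)) = 2 * (B ^ 2 * ρ ^ 3) := by ring
    have e2 : (B * ρ) * B * (ρ * ρ) = B ^ 2 * ρ ^ 3 := by ring
    have e3 : B * (B * ρ) * ρ ^ 2 = B ^ 2 * ρ ^ 3 := by ring
    have e4 : C₀ * ρ ^ 3 = 20 * (B ^ 2 * ρ ^ 3) + 2 * (B * ρ ^ 3) := by rw [hC₀]; ring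
    rw [e1] at a1
    rw [e2] at a2
    rw [e3] at a3
    rw [e4]
    constructor <;> linarith
  have hφ₁' : |φ₁| ≤ 1 / (2 * ρ ^ 2) + A / (2 * ρ) := by
    rw [hφ₁]
    refine (abs_add_le _ _).trans (le_of_eq ?_)
    rw [neg_div, abs_neg, abs_of_nonneg (by positivity), abs_of_nonneg (by positivity)]
  have hφ₂' : |φ₂| ≤ 1 / (2 * ρ ^ 4) + A / (4 * ρ ^ 3) := by
    rw [hφ₂]
    refine (abs_sub _ _).trans (le_of_eq ?_)
    rw [abs_of_nonneg (by positivity), abs_of_nonneg (by positivity)]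
  have m1 : |φ₁ * e₁| ≤ C₀ / (2 * ρ) + C₀ * A / 2 := by
    rw [abs_mul]
    calc _ ≤ (1 / (2 * ρ ^ 2) + A / (2 * ρ)) * (C₀ * ρ) := by gcongr
      _ = _ := by field_simp
  have m2 : |φ₂ * e₂| ≤ C₀ / (2 * ρ) + C₀ * A / 4 := by
    rw [abs_mul]
    calc _ ≤ (1 / (2 * ρ ^ 4) + A / (4 * ρ ^ 3)) * (C₀ * ρ ^ 3) := by gcongr
      _ = _ := by field_simp
  have m3 : |φ₁ * (2 * q ^ 2 * X)| + |φ₁ * (2 * T)| ≤ 2 / ρ + 2 * A := by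
    have : |φ₁ * (2 * q ^ 2 * X)| + |φ₁ * (2 * T)| = |φ₁| * (2 * |q ^ 2 * X| + 2 * |T|) := by
      rw [mul_assoc 2 (q ^ 2), abs_mul φ₁, abs_mul φ₁, abs_mul 2, abs_mul 2 T, abs_two]; ring
    rw [this]
    calc _ ≤ (1 / (2 * ρ ^ 2) + A / (2 * ρ)) * (2 * ρ + 2 * ρ) := by gcongr
      _ = _ := by field_simp; ring
  have main : φ₁ * 4 + φ₂ * (4 * ρ ^ 2) = A / ρ := by
    rw [hφ₁, hφ₂]; field_simp; ring
  have hinv : 1 + (C₀ + 2 * C) * A ≤ 1 / ρ := by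
    rw [le_div_iff₀ hρ]; linarith
  have expand : φ₁ * ((1 + r ^ 2) * (2 * q ^ 2) + (1 + p ^ 2) * 2 + d * (2 * T))
      + φ₂ * graphQuad p r (2 * q ^ 2 * X) (2 * T) = A / ρ + φ₁ * e₁ + φ₂ * e₂ := by
    rw [← main, he₁, he₂]; ring
  rw [expand]
  have m4 := neg_abs_le (φ₁ * e₁)
  have m5 := neg_abs_le (φ₂ * e₂)
  have m6 := mul_le_mul_of_nonneg_left m3 hC
  have hAρ : A / ρ = (C₀ + 2 * C) * (1 / ρ) + 1 / ρ := by rw [hA]; ring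
  have hh : C₀ / (2 * ρ) = C₀ * (1 / ρ) / 2 := by field_simp
  have hh2 : C * (2 / ρ + 2 * A) = 2 * C * (1 / ρ) + 2 * C * A := by ring
  linarith [mul_nonneg hC₀0 hA0]

/-- The linearised graph operator `(1 + r²) h_ss - 2 p r h_st + (1 + p²) h_tt + d h_t`. -/
def ell (p r d : ℝ) (h : ℝ × ℝ → ℝ) (x : ℝ × ℝ) : ℝ :=
  (1 + r ^ 2) * pds (pds h) x - 2 * p * r * pdt (pds h) x + (1 + p ^ 2) * pdt (pdt h) x
    + d * pdt h x

section Ell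

variable {Ω : Set (ℝ × ℝ)} {f g h : ℝ × ℝ → ℝ} {x : ℝ × ℝ}

lemma dirD_dirD_add (hΩ : IsOpen Ω) (hf : ContDiffOn ℝ (⊤ : ℕ∞) f Ω)
    (hg : ContDiffOn ℝ (⊤ : ℕ∞) g Ω) (hx : x ∈ Ω) (v w : ℝ × ℝ) :
    dirD v (dirD w (fun y => f y + g y)) x = dirD v (dirD w f) x + dirD v (dirD w g) x := by
  rw [dirD_congr (eventuallyEq_of_eqOn hΩ hx fun y hy => dirD_add hΩ hf hg hy w) v,
    dirD_add hΩ (smooth_dirD hΩ hf w) (smooth_dirD hΩ hg w) hx]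

lemma dirD_dirD_const_mul (hΩ : IsOpen Ω) (hf : ContDiffOn ℝ (⊤ : ℕ∞) f Ω) (hx : x ∈ Ω) (a : ℝ)
    (v w : ℝ × ℝ) : dirD v (dirD w (fun y => a * f y)) x = a * dirD v (dirD w f) x := by
  rw [dirD_congr (eventuallyEq_of_eqOn hΩ hx fun y hy => dirD_const_mul hΩ hf hy a w) v,
    dirD_const_mul hΩ (smooth_dirD hΩ hf w) hx]

lemma ell_add (hΩ : IsOpen Ω) (hf : ContDiffOn ℝ (⊤ : ℕ∞) f Ω)
    (hg : ContDiffOn ℝ (⊤ : ℕ∞) g Ω) (hx : x ∈ Ω) (p r d : ℝ) :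
    ell p r d (fun y => f y + g y) x = ell p r d f x + ell p r d g x := by
  simp only [ell, pds_eq_dirD, pdt_eq_dirD, dirD_dirD_add hΩ hf hg hx, dirD_add hΩ hf hg hx]
  ring

lemma ell_const_mul (hΩ : IsOpen Ω) (hf : ContDiffOn ℝ (⊤ : ℕ∞) f Ω) (hx : x ∈ Ω)
    (a p r d : ℝ) : ell p r d (fun y => a * f y) x = a * ell p r d f x := by
  simp only [ell, pds_eq_dirD, pdt_eq_dirD, dirD_dirD_const_mul hΩ hf hx,
    dirD_const_mul hΩ hf hx]
  ring

lemma dirD_comp {φ : ℝ → ℝ} {φ' : ℝ} (hφ : HasDerivAt φ φ' (h x)) (hh : DifferentiableAt ℝ h x)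
    (v : ℝ × ℝ) : dirD v (fun y => φ (h y)) x = φ' * dirD v h x :=
  (hφ.comp_hasFDerivAt x hh.hasFDerivAt).dirD_eq v

lemma dirD_dirD_comp (hΩ : IsOpen Ω) (hh : ContDiffOn ℝ (⊤ : ℕ∞) h Ω) (hx : x ∈ Ω)
    {φ φ₁ : ℝ → ℝ} {φ₂ : ℝ} (hφ : ∀ y ∈ Ω, HasDerivAt φ (φ₁ (h y)) (h y))
    (hφ₁ : HasDerivAt φ₁ φ₂ (h x)) (v w : ℝ × ℝ) :
    dirD v (dirD w (fun y => φ (h y))) x =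
      φ₁ (h x) * dirD v (dirD w h) x + φ₂ * (dirD v h x * dirD w h x) := by
  have hd : ∀ y ∈ Ω, DifferentiableAt ℝ h y := fun y hy =>
    (smooth_hasFDerivAt hΩ hh hy).differentiableAt
  rw [dirD_congr (eventuallyEq_of_eqOn hΩ hx fun y hy => dirD_comp (hφ y hy) (hd y hy) w) v]
  refine (((hφ₁.comp_hasFDerivAt x (hd x hx).hasFDerivAt).mul
      (smooth_hasFDerivAt hΩ (smooth_dirD hΩ hh w) hx)).dirD_eq v).trans ?_
  simp [dirD]
  ring

lemma ell_comp (hΩ : IsOpen Ω) (hh : ContDiffOn ℝ (⊤ : ℕ∞) h Ω) (hx : x ∈ Ω)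
    {φ φ₁ : ℝ → ℝ} {φ₂ : ℝ} (hφ : ∀ y ∈ Ω, HasDerivAt φ (φ₁ (h y)) (h y))
    (hφ₁ : HasDerivAt φ₁ φ₂ (h x)) (p r d : ℝ) :
    ell p r d (fun y => φ (h y)) x =
      φ₁ (h x) * ell p r d h x + φ₂ * graphQuad p r (pds h x) (pdt h x) := by
  have hd := (smooth_hasFDerivAt hΩ hh hx).differentiableAt
  simp only [ell, graphQuad, pds_eq_dirD, pdt_eq_dirD, dirD_dirD_comp hΩ hh hx hφ hφ₁,
    dirD_comp (hφ x hx) hd]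
  ring

lemma ell_nonpos_of_isLocalMax (hΩ : IsOpen Ω) (hh : ContDiffOn ℝ (⊤ : ℕ∞) h Ω) (hx : x ∈ Ω)
    (hmax : IsLocalMax h x) (p r d : ℝ) : pds h x = 0 ∧ pdt h x = 0 ∧ ell p r d h x ≤ 0 := by
  have hc : ContDiffAt ℝ 2 h x := (hh.contDiffAt (hΩ.mem_nhds hx)).of_le two_le_smooth
  have h1 := isLocalMax_dirD hc hmax (1, 0)
  have h2 := isLocalMax_dirD hc hmax (0, 1)
  have h3 := (isLocalMax_dirD hc hmax (r, -p)).2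
  have e : dirD (r, -p) (dirD (r, -p) h) x =
      r ^ 2 * pds (pds h) x - 2 * p * r * pdt (pds h) x + p ^ 2 * pdt (pdt h) x := by
    have e1 : dirD (r, -p) h = fun y => r * pds h y + -p * pdt h y := funext (dirD_eq _ h)
    have hs := smooth_pds hΩ hh
    have ht := smooth_pdt hΩ hh
    rw [e1, dirD_add hΩ (contDiffOn_const.mul hs) (contDiffOn_const.mul ht) hx,
      dirD_const_mul hΩ hs hx, dirD_const_mul hΩ ht hx, dirD_eq _ (pds h), dirD_eq _ (pdt h)]
    have := dirD_comm hΩ hh hx (1, 0) (0, 1)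
    rw [← pds_eq_dirD, ← pdt_eq_dirD, ← pds_eq_dirD, ← pdt_eq_dirD] at this
    rw [this]
    ring
  refine ⟨h1.1, h2.1, ?_⟩
  have h4 : pdt h x = 0 := h2.1
  have h5 : pds (pds h) x ≤ 0 := h1.2
  have h6 : pdt (pdt h) x ≤ 0 := h2.2
  rw [ell, h4]
  linarith

end Ell

section Gradient

variable {Ω : Set (ℝ × ℝ)} {u : ℝ × ℝ → ℝ} {x : ℝ × ℝ} {c k : ℝ}

/-- The translator equation written for `σ = c k`. -/
def TranslatorEq (c k : ℝ) (u : ℝ × ℝ → ℝ) (y : ℝ × ℝ) : Prop :=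
  (1 + pdt u y ^ 2) * pds (pds u) y - 2 * pds u y * pdt u y * pdt (pds u) y
    + (1 + pds u y ^ 2) * pdt (pdt u) y = (1 + pds u y ^ 2 + pdt u y ^ 2) * (c * (k - pdt u y))

lemma ell_dirD_of_translatorEq (hΩ : IsOpen Ω) (hu : ContDiffOn ℝ (⊤ : ℕ∞) u Ω) (hx : x ∈ Ω)
    (hpde : ∀ y ∈ Ω, TranslatorEq c k u y) (v : ℝ × ℝ) :
    ell (pds u x) (pdt u x) (c * (1 + pds u x ^ 2 + pdt u x ^ 2)) (dirD v u) x =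
      (2 * pds u x * pds (dirD v u) x + 2 * pdt u x * pdt (dirD v u) x) * (c * (k - pdt u x))
      - 2 * pdt u x * pdt (dirD v u) x * pds (pds u) x
      + 2 * (pds (dirD v u) x * pdt u x + pds u x * pdt (dirD v u) x) * pdt (pds u) x
      - 2 * pds u x * pds (dirD v u) x * pdt (pdt u) x := by
  have hs := smooth_pds hΩ hu
  have ht := smooth_pdt hΩ hu
  have key : ∀ f : ℝ × ℝ → ℝ, ContDiffOn ℝ (⊤ : ℕ∞) f Ω →
      HasDerivAt (fun s : ℝ => f (x + s • v)) (dirD v f x) 0 := by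
    intro f hf
    have := hasDerivAt_line (h := f) (x := x) (v := v) (s := 0)
      (by simpa using (smooth_hasFDerivAt hΩ hf hx).differentiableAt)
    simpa using this
  have dP := key _ hs
  have dR := key _ ht
  have dL := key _ (smooth_pds hΩ hs)
  have dM := key _ (smooth_pdt hΩ hs)
  have dN := key _ (smooth_pdt hΩ ht)
  have H1 := ((((dR.pow 2).const_add 1).mul dL).sub ((((dP.mul dR).mul dM)).const_mul 2)).add
    (((dP.pow 2).const_add 1).mul dN)
  have H2 := (((dP.pow 2).add (dR.pow 2)).const_add 1).mul ((dR.const_sub k).const_mul c)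
  have hev : ∀ᶠ s : ℝ in 𝓝 0, x + s • v ∈ Ω := (tendsto_line x v).eventually (hΩ.mem_nhds hx)
  have e := H1.unique (H2.congr_of_eventuallyEq (hev.mono fun s hs => by
    have := hpde _ hs
    unfold TranslatorEq at this
    simp only [Pi.add_apply, Pi.sub_apply, Pi.mul_apply, Pi.pow_apply]
    linear_combination this))
  simp only [zero_smul, add_zero, Pi.pow_apply, Pi.mul_apply, Pi.add_apply] at e
  have c1 : dirD v (pds u) x = pds (dirD v u) x := dirD_comm hΩ hu hx _ _
  have c2 : dirD v (pdt u) x = pdt (dirD v u) x := dirD_comm hΩ hu hx _ _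
  have c3 : ∀ a b : ℝ × ℝ, dirD v (dirD a (dirD b u)) x = dirD a (dirD b (dirD v u)) x := by
    intro a b
    rw [dirD_comm hΩ (smooth_dirD hΩ hu b) hx,
      dirD_congr (eventuallyEq_of_eqOn hΩ hx fun y hy => dirD_comm hΩ hu hy v b) a]
  have c4 : dirD v (pds (pds u)) x = pds (pds (dirD v u)) x := c3 _ _
  have c5 : dirD v (pdt (pds u)) x = pdt (pds (dirD v u)) x := c3 _ _
  have c6 : dirD v (pdt (pdt u)) x = pdt (pdt (dirD v u)) x := c3 _ _
  rw [c1, c2, c4, c5, c6] at e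
  unfold ell
  simp only [Nat.cast_ofNat, Nat.add_one_sub_one, pow_one] at e
  linear_combination e

/-- The function `(1 + k²) p² + (k - r)²`, a squared distance between the gradient `(p, r)` and
`(0, k)`. -/
def gradDefect (k : ℝ) (u : ℝ × ℝ → ℝ) (y : ℝ × ℝ) : ℝ :=
  (1 + k ^ 2) * pds u y ^ 2 + (k - pdt u y) ^ 2

lemma gradDefect_nonneg (k : ℝ) (u : ℝ × ℝ → ℝ) (y : ℝ × ℝ) : 0 ≤ gradDefect k u y := by
  unfold gradDefect; positivity

lemma smooth_gradDefect (hΩ : IsOpen Ω) (hu : ContDiffOn ℝ (⊤ : ℕ∞) u Ω) :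
    ContDiffOn ℝ (⊤ : ℕ∞) (gradDefect k u) Ω :=
  (contDiffOn_const.mul ((smooth_pds hΩ hu).pow 2)).add
    ((contDiffOn_const.sub (smooth_pdt hΩ hu)).pow 2)

lemma bochner_gradDefect {M : ℝ} (hΩ : IsOpen Ω) (hu : ContDiffOn ℝ (⊤ : ℕ∞) u Ω) (hx : x ∈ Ω)
    (hpde : ∀ y ∈ Ω, TranslatorEq c k u y)
    (hk : 1 + k * pdt u x ≠ 0) (hpM : |pds u x| ≤ M) (hrM : |pdt u x| ≤ M)
    (hDM : |pds (pds u) x * pdt (pdt u) x - pdt (pds u) x ^ 2| ≤ M)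
    (hcM : |c / (1 + k * pdt u x)| ≤ M)
    (hEM : gradDefect k u x + 2 * (1 + k * pdt u x) ^ 2 ≤ M)
    (hωM : |2 * pds u x * pds (pds u) x + 2 * pdt u x * pdt (pds u) x|
      + |2 * pds u x * pdt (pds u) x + 2 * pdt u x * pdt (pdt u) x| ≤ M) :
    -((2 * M + 2 * M ^ 2 * (1 + M ^ 2) * (1 + M)) * (gradDefect k u x ^ 2
        + gradDefect k u x * (|pds (gradDefect k u) x| + |pdt (gradDefect k u) x|))) ≤
      gradDefect k u x *
        ell (pds u x) (pdt u x) (c * (1 + pds u x ^ 2 + pdt u x ^ 2)) (gradDefect k u) x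
      - graphQuad (pds u x) (pdt u x) (pds (gradDefect k u) x) (pdt (gradDefect k u) x) := by
  have hs := smooth_pds hΩ hu
  have ht := smooth_pdt hΩ hu
  have hst : pds (pdt u) x = pdt (pds u) x := dirD_comm hΩ hu hx _ _
  have hs2 : ContDiffOn ℝ (⊤ : ℕ∞) (fun y => pds u y ^ 2) Ω := hs.pow 2
  have ht2 : ContDiffOn ℝ (⊤ : ℕ∞) (fun y => (k - pdt u y) ^ 2) Ω :=
    (contDiffOn_const.sub ht).pow 2
  have dφ : ∀ a : ℝ, HasDerivAt (fun s : ℝ => s ^ 2) (2 * a) a := fun a => by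
    simpa using hasDerivAt_pow 2 a
  have dφ₁ : ∀ a : ℝ, HasDerivAt (fun s : ℝ => 2 * s) 2 a := fun a => by
    simpa using (hasDerivAt_id a).const_mul 2
  have dψ : ∀ a : ℝ, HasDerivAt (fun s : ℝ => (k - s) ^ 2) (-(2 * (k - a))) a := fun a => by
    simpa using ((hasDerivAt_id a).const_sub k).fun_pow 2
  have dψ₁ : ∀ a : ℝ, HasDerivAt (fun s : ℝ => -(2 * (k - s))) 2 a := fun a => by
    simpa using (((hasDerivAt_id a).const_sub k).const_mul 2).fun_neg
  have hEdir : ∀ v, dirD v (gradDefect k u) x =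
      2 * (1 + k ^ 2) * pds u x * dirD v (pds u) x - 2 * (k - pdt u x) * dirD v (pdt u) x := by
    intro v
    have := dirD_add hΩ (contDiffOn_const (c := 1 + k ^ 2) |>.mul hs2) ht2 hx v
    refine this.trans ?_
    rw [dirD_const_mul hΩ hs2 hx,
      dirD_comp (dφ _) (smooth_hasFDerivAt hΩ hs hx).differentiableAt,
      dirD_comp (φ := fun s => (k - s) ^ 2) (dψ _) (smooth_hasFDerivAt hΩ ht hx).differentiableAt]
    ring
  refine bochner_inequality (l := pds (pds u) x) (m := pdt (pds u) x) (n := pdt (pdt u) x)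
    (k := k) (c := c) rfl rfl rfl ?_ ?_ rfl rfl ?_ (hpde x hx) hk hpM hrM hDM hcM hEM hωM
  · rw [pds_eq_dirD, hEdir, ← pds_eq_dirD, ← pds_eq_dirD, hst]
  · rw [pdt_eq_dirD, hEdir]; rfl
  · have h1 := ell_dirD_of_translatorEq hΩ hu hx hpde (1, 0)
    have h2 := ell_dirD_of_translatorEq hΩ hu hx hpde (0, 1)
    rw [← pds_eq_dirD] at h1
    rw [← pdt_eq_dirD, hst] at h2
    have := ell_add hΩ (contDiffOn_const (c := 1 + k ^ 2) |>.mul hs2) ht2 hx (pds u x) (pdt u x)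
      (c * (1 + pds u x ^ 2 + pdt u x ^ 2))
    refine this.trans ?_
    rw [ell_const_mul hΩ hs2 hx, ell_comp hΩ hs hx (fun y _ => dφ _) (dφ₁ _),
      ell_comp (φ := fun s => (k - s) ^ 2) hΩ ht hx (fun y _ => dψ _) (dψ₁ _), h1, h2, hst]
    ring

end Gradient

/-- The squared distance to `x₀` for the metric `q² ds² + dt²`. -/
def radSq (q : ℝ) (x₀ y : ℝ × ℝ) : ℝ := q ^ 2 * (y.1 - x₀.1) ^ 2 + (y.2 - x₀.2) ^ 2

/-- The logarithm `A ρ - log ρ` of the Carleman weight, with `ρ² = radSq q x₀`. -/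
def logWeight (A q : ℝ) (x₀ y : ℝ × ℝ) : ℝ :=
  A * √(radSq q x₀ y) - Real.log (√(radSq q x₀ y))

lemma dirD_affine (a b s : ℝ) (v x : ℝ × ℝ) :
    dirD v (fun y => a * y.1 + b * y.2 + s) x = a * v.1 + b * v.2 := by
  have h1 : HasFDerivAt (fun y : ℝ × ℝ => a * y.1 + b * y.2 + s)
      (a • ContinuousLinearMap.fst ℝ ℝ ℝ + b • ContinuousLinearMap.snd ℝ ℝ ℝ) x :=
    ((hasFDerivAt_fst.const_mul a).add (hasFDerivAt_snd.const_mul b)).add_const s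
  rw [h1.dirD_eq]
  simp

section Weight

variable {Ω : Set (ℝ × ℝ)} {u : ℝ × ℝ → ℝ} {x x₀ : ℝ × ℝ} {c k q A : ℝ}

lemma smooth_radSq (q : ℝ) (x₀ : ℝ × ℝ) : ContDiff ℝ (⊤ : ℕ∞) (radSq q x₀) := by
  unfold radSq; fun_prop

lemma dirD_radSq (q : ℝ) (x₀ y v : ℝ × ℝ) :
    dirD v (radSq q x₀) y = 2 * q ^ 2 * (y.1 - x₀.1) * v.1 + 2 * (y.2 - x₀.2) * v.2 := by
  have h1 : HasFDerivAt (fun y : ℝ × ℝ => y.1 - x₀.1) (ContinuousLinearMap.fst ℝ ℝ ℝ) y :=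
    hasFDerivAt_fst.sub_const _
  have h2 : HasFDerivAt (fun y : ℝ × ℝ => y.2 - x₀.2) (ContinuousLinearMap.snd ℝ ℝ ℝ) y :=
    hasFDerivAt_snd.sub_const _
  refine ((((h1.pow 2).const_mul (q ^ 2)).add (h2.pow 2)).dirD_eq v).trans ?_
  simp
  ring

lemma dirD_dirD_radSq (q : ℝ) (x₀ y v w : ℝ × ℝ) :
    dirD v (dirD w (radSq q x₀)) y = 2 * q ^ 2 * v.1 * w.1 + 2 * v.2 * w.2 := by
  have : dirD w (radSq q x₀) = fun y => (2 * q ^ 2 * w.1) * y.1 + (2 * w.2) * y.2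
      + (-(2 * q ^ 2 * x₀.1 * w.1) - 2 * x₀.2 * w.2) := by
    ext y; rw [dirD_radSq]; ring
  rw [this, dirD_affine]
  ring

lemma ell_radSq (p r d q : ℝ) (x₀ y : ℝ × ℝ) : ell p r d (radSq q x₀) y =
    (1 + r ^ 2) * (2 * q ^ 2) + (1 + p ^ 2) * 2 + d * (2 * (y.2 - x₀.2)) := by
  simp only [ell, pds_eq_dirD, pdt_eq_dirD, dirD_dirD_radSq, dirD_radSq]
  ring

lemma hasDerivAt_weight (A : ℝ) {s : ℝ} (hs : 0 < s) :
    HasDerivAt (fun s : ℝ => A * √s - Real.log (√s)) (-1 / (2 * s) + A / (2 * √s)) s := by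
  have h1 := Real.hasDerivAt_sqrt hs.ne'
  have hp := Real.sqrt_pos.2 hs
  refine ((h1.const_mul A).sub (h1.log hp.ne')).congr_deriv ?_
  obtain ⟨ρ, hρ, rfl⟩ : ∃ ρ : ℝ, 0 < ρ ∧ s = ρ ^ 2 := ⟨√s, hp, (Real.sq_sqrt hs.le).symm⟩
  rw [Real.sqrt_sq hρ.le]
  field_simp
  ring

lemma hasDerivAt_weight_deriv (A : ℝ) {s : ℝ} (hs : 0 < s) :
    HasDerivAt (fun s : ℝ => -1 / (2 * s) + A / (2 * √s))
      (1 / (2 * √s ^ 4) - A / (4 * √s ^ 3)) s := by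
  have h1 := Real.hasDerivAt_sqrt hs.ne'
  have hp := Real.sqrt_pos.2 hs
  refine (((hasDerivAt_const s (-1 : ℝ)).div ((hasDerivAt_id s).const_mul 2)
    (by simpa using hs.ne')).add ((hasDerivAt_const s A).div (h1.const_mul 2)
    (by positivity))).congr_deriv ?_
  obtain ⟨ρ, hρ, rfl⟩ : ∃ ρ : ℝ, 0 < ρ ∧ s = ρ ^ 2 := ⟨√s, hp, (Real.sq_sqrt hs.le).symm⟩
  rw [Real.sqrt_sq hρ.le]
  simp only [id]
  field_simp
  ring

lemma not_isLocalMax_log_gradDefect {M B : ℝ} {n : ℝ} (hΩ : IsOpen Ω)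
    (hu : ContDiffOn ℝ (⊤ : ℕ∞) u Ω) (hx : x ∈ Ω) (hpde : ∀ y ∈ Ω, TranslatorEq c k u y)
    (hk : 1 + k * pdt u x ≠ 0) (hpM : |pds u x| ≤ M) (hrM : |pdt u x| ≤ M)
    (hDM : |pds (pds u) x * pdt (pdt u) x - pdt (pds u) x ^ 2| ≤ M)
    (hcM : |c / (1 + k * pdt u x)| ≤ M)
    (hEM : gradDefect k u x + 2 * (1 + k * pdt u x) ^ 2 ≤ M)
    (hωM : |2 * pds u x * pds (pds u) x + 2 * pdt u x * pdt (pds u) x|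
      + |2 * pds u x * pdt (pds u) x + 2 * pdt u x * pdt (pdt u) x| ≤ M)
    (hE : 0 < gradDefect k u x) (hρ : 0 < √(radSq q x₀ x)) (hq : q ^ 2 * (1 + k ^ 2) = 1)
    (hp : |pds u x| ≤ B * √(radSq q x₀ x)) (hr : |pdt u x - k| ≤ B * √(radSq q x₀ x))
    (hpB : |pds u x| ≤ B) (hrB : |pdt u x| ≤ B) (hkB : |k| ≤ B)
    (hdB : |c * (1 + pds u x ^ 2 + pdt u x ^ 2)| ≤ B) {C : ℝ}
    (hC : C = 2 * M + 2 * M ^ 2 * (1 + M ^ 2) * (1 + M)) (hn : C < n)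
    (hA : A = 20 * B ^ 2 + 2 * B + 2 * C + 1)
    (hsmall : √(radSq q x₀ x) * (1 + (20 * B ^ 2 + 2 * B + 2 * C) * A) ≤ 1) :
    ¬ IsLocalMax (fun y => Real.log (gradDefect k u y) + n * logWeight A q x₀ y) x := by
  intro hmax
  set E := gradDefect k u with hEdef
  set R := radSq q x₀ with hRdef
  have hM : 0 ≤ M := (abs_nonneg _).trans hpM
  have hC0 : 0 ≤ C := by rw [hC]; positivity
  have hEs : ContDiffOn ℝ (⊤ : ℕ∞) E Ω := smooth_gradDefect hΩ hu
  set V := Ω ∩ {y | 0 < E y} ∩ {y | 0 < R y} with hV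
  have hRx : 0 < R x := Real.sqrt_pos.1 hρ
  have hVo : IsOpen V := (hEs.continuousOn.isOpen_inter_preimage hΩ isOpen_Ioi).inter
    (isOpen_lt continuous_const (smooth_radSq q x₀).continuous)
  have hxV : x ∈ V := ⟨⟨hx, hE⟩, hRx⟩
  have hEV : ContDiffOn ℝ (⊤ : ℕ∞) E V := hEs.mono fun y hy => hy.1.1
  have hRV : ContDiffOn ℝ (⊤ : ℕ∞) R V := (smooth_radSq q x₀).contDiffOn
  have hlog : ContDiffOn ℝ (⊤ : ℕ∞) (fun y => Real.log (E y)) V :=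
    hEV.log fun y hy => hy.1.2.ne'
  have hsq : ContDiffOn ℝ (⊤ : ℕ∞) (fun y => √(R y)) V := hRV.sqrt fun y hy => (hy.2 : 0 < R y).ne'
  have hwt : ContDiffOn ℝ (⊤ : ℕ∞) (logWeight A q x₀) V :=
    (contDiffOn_const.mul hsq).sub (hsq.log fun y hy => (Real.sqrt_pos.2 hy.2).ne')
  have hnw : ContDiffOn ℝ (⊤ : ℕ∞) (fun y => n * logWeight A q x₀ y) V := contDiffOn_const.mul hwt
  set p := pds u x
  set r := pdt u x
  set d := c * (1 + p ^ 2 + r ^ 2)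
  obtain ⟨m1, m2, m3⟩ := ell_nonpos_of_isLocalMax hVo (hlog.add hnw) hxV hmax p r d
  set φ₁ := -1 / (2 * √(R x) ^ 2) + A / (2 * √(R x)) with hφ₁
  set φ₂ := 1 / (2 * √(R x) ^ 4) - A / (4 * √(R x) ^ 3) with hφ₂
  have hsqx : √(R x) ^ 2 = R x := Real.sq_sqrt hRx.le
  have dEx : ∀ v, dirD v (fun y => Real.log (E y)) x = (E x)⁻¹ * dirD v E x := fun v =>
    dirD_comp (Real.hasDerivAt_log hE.ne') (smooth_hasFDerivAt hVo hEV hxV).differentiableAt v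
  have dWx : ∀ v, dirD v (logWeight A q x₀) x = φ₁ * dirD v R x := fun v => by
    rw [hφ₁, hsqx]
    exact dirD_comp (hasDerivAt_weight A hRx) (smooth_hasFDerivAt hVo hRV hxV).differentiableAt v
  have dG : ∀ v, dirD v (fun y => Real.log (E y) + n * logWeight A q x₀ y) x =
      (E x)⁻¹ * dirD v E x + n * (φ₁ * dirD v R x) := fun v => by
    rw [dirD_add hVo hlog hnw hxV, dirD_const_mul hVo hwt hxV, dEx, dWx]
  have gs := dG (1, 0)
  have gt := dG (0, 1)
  simp only [← pds_eq_dirD, ← pdt_eq_dirD] at gs gt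
  rw [m1] at gs
  rw [m2] at gt
  have ellE : ell p r d (fun y => Real.log (E y)) x =
      (E x)⁻¹ * ell p r d E x + -(E x ^ 2)⁻¹ * graphQuad p r (pds E x) (pdt E x) :=
    ell_comp (φ₁ := fun s => s⁻¹) hVo hEV hxV (fun y hy => Real.hasDerivAt_log hy.1.2.ne')
      (hasDerivAt_inv hE.ne') p r d
  have ellW : ell p r d (logWeight A q x₀) x =
      φ₁ * ell p r d R x + φ₂ * graphQuad p r (pds R x) (pdt R x) := by
    rw [hφ₁, hsqx]
    exact ell_comp hVo hRV hxV (fun y hy => hasDerivAt_weight A hy.2)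
      (hasDerivAt_weight_deriv A hRx) p r d
  rw [ell_add hVo hlog hnw hxV, ell_const_mul hVo hwt hxV, ellE, ellW, ell_radSq] at m3
  have hRs : pds R x = 2 * q ^ 2 * (x.1 - x₀.1) := by
    rw [pds_eq_dirD, dirD_radSq]; ring
  have hRt : pdt R x = 2 * (x.2 - x₀.2) := by
    rw [pdt_eq_dirD, dirD_radSq]; ring
  have rad := radial_weight_inequality (X := x.1 - x₀.1) (T := x.2 - x₀.2) hρ hsqx hq hp hr hpB
    hrB hkB hdB hC0 hA hsmall hφ₁ hφ₂
  have boch := bochner_gradDefect hΩ hu hx hpde hk hpM hrM hDM hcM hEM hωM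
  rw [← hC] at boch
  rw [hRs] at gs m3
  rw [hRt] at gt m3
  have hs : |pds E x| = n * |φ₁ * (2 * q ^ 2 * (x.1 - x₀.1))| * E x := by
    have : pds E x = -(n * (φ₁ * (2 * q ^ 2 * (x.1 - x₀.1))) * E x) := by
      field_simp at gs; linarith
    rw [this, abs_neg, abs_mul, abs_mul, abs_of_pos hE, abs_of_pos (hC0.trans_lt hn)]
  have ht : |pdt E x| = n * |φ₁ * (2 * (x.2 - x₀.2))| * E x := by
    have : pdt E x = -(n * (φ₁ * (2 * (x.2 - x₀.2))) * E x) := by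
      field_simp at gt; linarith
    rw [this, abs_neg, abs_mul, abs_mul, abs_of_pos hE, abs_of_pos (hC0.trans_lt hn)]
  change -(C * (E x ^ 2 + E x * (|pds E x| + |pdt E x|))) ≤
    E x * ell p r d E x - graphQuad p r (pds E x) (pdt E x) at boch
  rw [hs, ht] at boch
  set a := |φ₁ * (2 * q ^ 2 * (x.1 - x₀.1))|
  set b := |φ₁ * (2 * (x.2 - x₀.2))|
  have b2 : -(C * (1 + n * (a + b))) ≤
      (E x)⁻¹ * ell p r d E x + -(E x ^ 2)⁻¹ * graphQuad p r (pds E x) (pdt E x) := by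
    have : (E x)⁻¹ * ell p r d E x + -(E x ^ 2)⁻¹ * graphQuad p r (pds E x) (pdt E x) =
      (E x * ell p r d E x - graphQuad p r (pds E x) (pdt E x)) / E x ^ 2 := by
      field_simp
      ring
    rw [this, le_div_iff₀ (by positivity)]
    linarith
  have r2 := mul_le_mul_of_nonneg_left rad (hC0.trans hn.le)
  linarith

end Weight

section Carleman

variable {x₀ : ℝ × ℝ} {q A ρ₀ : ℝ}

lemma continuous_sqrt_radSq (q : ℝ) (x₀ : ℝ × ℝ) : Continuous fun y => √(radSq q x₀ y) :=
  (smooth_radSq q x₀).continuous.sqrt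

lemma mul_norm_le_sqrt_radSq (hq : 0 < q) (hq1 : q ≤ 1) (y : ℝ × ℝ) :
    q * ‖y - x₀‖ ≤ √(radSq q x₀ y) := by
  apply Real.le_sqrt_of_sq_le
  unfold radSq
  have h1 : q ^ 2 ≤ 1 := by nlinarith
  rcases max_choice ‖(y - x₀).1‖ ‖(y - x₀).2‖ with h | h <;>
  · rw [Prod.norm_def, h, Real.norm_eq_abs, mul_pow, sq_abs, Prod.sub_def]
    nlinarith [sq_nonneg (y.1 - x₀.1), sq_nonneg (y.2 - x₀.2), sq_nonneg q,
      mul_nonneg (sq_nonneg q) (sq_nonneg (y.1 - x₀.1)),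
      mul_le_mul_of_nonneg_right h1 (sq_nonneg (y.2 - x₀.2))]

lemma norm_le_of_sqrt_radSq (hq : 0 < q) (hq1 : q ≤ 1) (y : ℝ × ℝ) :
    ‖y - x₀‖ ≤ q⁻¹ * √(radSq q x₀ y) := by
  rw [← div_eq_inv_mul, le_div_iff₀ hq, mul_comm]
  exact mul_norm_le_sqrt_radSq hq hq1 y

lemma exists_radius_of_eventually {P : ℝ × ℝ → Prop} (hq : 0 < q) (hq1 : q ≤ 1)
    (H : ∀ᶠ y in 𝓝 x₀, P y) : ∃ δ > 0, ∀ y, √(radSq q x₀ y) < δ → P y := by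
  obtain ⟨ε, hε, h⟩ := Metric.eventually_nhds_iff.1 H
  refine ⟨q * ε, by positivity, fun y hy => h ?_⟩
  rw [dist_eq_norm]
  exact lt_of_mul_lt_mul_left ((mul_norm_le_sqrt_radSq hq hq1 y).trans_lt hy) hq.le

lemma isCompact_sqrt_radSq_le (hq : 0 < q) (hq1 : q ≤ 1) (s : ℝ) :
    IsCompact {y | √(radSq q x₀ y) ≤ s} := by
  refine Metric.isCompact_of_isClosed_isBounded
    (isClosed_le (continuous_sqrt_radSq q x₀) continuous_const) ?_
  refine Metric.isBounded_closedBall (x := x₀) (r := q⁻¹ * s) |>.subset fun y hy => ?_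
  rw [mem_closedBall, dist_eq_norm]
  exact (norm_le_of_sqrt_radSq hq hq1 y).trans (by gcongr; exact hy)

lemma exists_boundary_of_no_interior_max {E : ℝ × ℝ → ℝ} (hq : 0 < q) (hq1 : q ≤ 1)
    (hE : ContinuousOn E {y | √(radSq q x₀ y) ≤ ρ₀}) {n : ℕ}
    (hv : ∃ C, ∀ᶠ y in 𝓝 x₀, E y ≤ C * √(radSq q x₀ y) ^ (n + 1))
    (hmax : ∀ x, 0 < √(radSq q x₀ x) → √(radSq q x₀ x) < ρ₀ → 0 < E x →
      ¬ IsLocalMax (fun y => Real.log (E y) + n * logWeight A q x₀ y) x)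
    {z : ℝ × ℝ} (hz0 : 0 < √(radSq q x₀ z)) (hz : √(radSq q x₀ z) < ρ₀) (hEz : 0 < E z) :
    ∃ y, √(radSq q x₀ y) = ρ₀ ∧
      E z * (Real.exp (A * √(radSq q x₀ z)) / √(radSq q x₀ z)) ^ n ≤
        E y * (Real.exp (A * ρ₀) / ρ₀) ^ n := by
  set ρ : ℝ × ℝ → ℝ := fun y => √(radSq q x₀ y) with hρdef
  have hρc : Continuous ρ := continuous_sqrt_radSq q x₀
  set F : ℝ × ℝ → ℝ := fun y => E y * (Real.exp (A * ρ y) / ρ y) ^ n with hF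
  have hFz : 0 < F z := by
    have : 0 < ρ z := hz0
    positivity
  obtain ⟨C, hC⟩ := hv
  obtain ⟨δ₁, hδ₁, hδ⟩ := exists_radius_of_eventually hq hq1 hC
  have hsm : Tendsto (fun s : ℝ => |C| * s * Real.exp (A * s) ^ n) (𝓝[>] 0) (𝓝 0) := by
    have : Continuous fun s : ℝ => |C| * s * Real.exp (A * s) ^ n := by fun_prop
    simpa using (this.tendsto 0).mono_left nhdsWithin_le_nhds
  obtain ⟨δ, hδF, hδ1, hδz, hδ0⟩ := ((hsm.eventually_lt_const hFz).and
    (((eventually_lt_nhds hδ₁).filter_mono nhdsWithin_le_nhds).and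
    (((eventually_lt_nhds hz0).filter_mono nhdsWithin_le_nhds).and
    self_mem_nhdsWithin))).exists
  replace hδ0 : 0 < δ := hδ0
  set K : Set (ℝ × ℝ) := {y | ρ y ≤ ρ₀} ∩ {y | δ ≤ ρ y} with hK
  have hKc : IsCompact K := (isCompact_sqrt_radSq_le hq hq1 ρ₀).inter_right
    (isClosed_le continuous_const hρc)
  have hFc : ContinuousOn F K := by
    refine (hE.mono Set.inter_subset_left).mul (ContinuousOn.pow (ContinuousOn.div ?_ ?_ ?_) n)
    · exact (Real.continuous_exp.comp (continuous_const.mul hρc)).continuousOn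
    · exact hρc.continuousOn
    · exact fun y hy => (hδ0.trans_le hy.2).ne'
  obtain ⟨y, hyK, hymax⟩ := hKc.exists_isMaxOn ⟨z, hz.le, hδz.le⟩ hFc
  have hzy : F z ≤ F y := hymax ⟨hz.le, hδz.le⟩
  have hρy : 0 < ρ y := hδ0.trans_le hyK.2
  have hEy : 0 < E y := by
    by_contra! hneg
    have : F y ≤ 0 := mul_nonpos_of_nonpos_of_nonneg hneg (by positivity)
    linarith
  have hyδ : δ < ρ y := by
    refine lt_of_le_of_ne hyK.2 fun heq => ?_
    have h1 : E y ≤ C * ρ y ^ (n + 1) := hδ y (show ρ y < δ₁ by rw [← heq]; exact hδ1)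
    have h2 : F y ≤ |C| * δ * Real.exp (A * δ) ^ n := by
      calc F y ≤ (|C| * ρ y ^ (n + 1)) * (Real.exp (A * ρ y) / ρ y) ^ n := by
            refine mul_le_mul_of_nonneg_right (h1.trans ?_) (by positivity)
            gcongr
            exact le_abs_self C
        _ = |C| * ρ y * Real.exp (A * ρ y) ^ n := by
            rw [div_pow, pow_succ]
            field_simp
        _ = _ := by rw [heq]
    linarith
  rcases (show ρ y ≤ ρ₀ from hyK.1).lt_or_eq with hlt | heq
  · exfalso
    refine hmax y hρy hlt hEy ?_
    have hKn : K ∈ 𝓝 y := inter_mem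
      ((hρc.continuousAt.eventually_lt_const hlt).mono fun _ h => h.le)
      ((hρc.continuousAt.eventually_const_lt hyδ).mono fun _ h => h.le)
    have hEn : ∀ᶠ x in 𝓝 y, 0 < E x :=
      (hE.continuousAt (mem_of_superset hKn Set.inter_subset_left)).eventually_const_lt hEy
    have hlog : ∀ x ∈ K, 0 < E x →
        Real.log (E x) + n * logWeight A q x₀ x = Real.log (F x) := by
      intro x hx hEx
      have hρx : 0 < ρ x := hδ0.trans_le hx.2
      rw [hF, Real.log_mul hEx.ne' (by positivity), Real.log_pow,
        Real.log_div (Real.exp_ne_zero _) hρx.ne', Real.log_exp, logWeight]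
    filter_upwards [hKn, hEn] with x hxK hEx
    rw [hlog x hxK hEx, hlog y hyK hEy]
    have hρx : 0 < ρ x := hδ0.trans_le hxK.2
    exact Real.log_le_log (by positivity) (hymax hxK)
  · refine ⟨y, heq, ?_⟩
    rw [← heq]
    exact hzy

lemma eventually_eq_zero_of_no_interior_max {E : ℝ × ℝ → ℝ} (hq : 0 < q) (hq1 : q ≤ 1)
    (hA : 0 ≤ A) (hρ₀ : 0 < ρ₀) (hE : ContinuousOn E {y | √(radSq q x₀ y) ≤ ρ₀})
    (hE0 : ∀ y, 0 ≤ E y) (hv : ∀ n : ℕ, ∃ C, ∀ᶠ y in 𝓝 x₀, E y ≤ C * √(radSq q x₀ y) ^ n)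
    {N : ℕ} (hmax : ∀ n : ℕ, N ≤ n → ∀ x, 0 < √(radSq q x₀ x) → √(radSq q x₀ x) < ρ₀ → 0 < E x →
      ¬ IsLocalMax (fun y => Real.log (E y) + n * logWeight A q x₀ y) x) :
    ∀ᶠ y in 𝓝 x₀, E y = 0 := by
  have hx₀ : √(radSq q x₀ x₀) = 0 := by simp [radSq]
  have hsmall : ∀ᶠ y in 𝓝 x₀, √(radSq q x₀ y) < ρ₀ * Real.exp (-(A * ρ₀)) :=
    (continuous_sqrt_radSq q x₀).continuousAt.eventually_lt_const
      (show √(radSq q x₀ x₀) < _ by rw [hx₀]; positivity)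
  obtain ⟨M, hM⟩ := (isCompact_sqrt_radSq_le (x₀ := x₀) hq hq1 ρ₀).bddAbove_image hE
  have hEx₀ : E x₀ = 0 := by
    obtain ⟨C, hC⟩ := hv 1
    have := hC.self_of_nhds
    rw [hx₀] at this
    exact le_antisymm (by simpa using this) (hE0 _)
  filter_upwards [hsmall] with z hz
  by_contra hne
  have hEz : 0 < E z := (hE0 z).lt_of_ne' hne
  have hρz : 0 < √(radSq q x₀ z) := by
    refine (Real.sqrt_nonneg _).lt_of_ne' fun h0 => ?_
    have h1 := norm_le_of_sqrt_radSq (x₀ := x₀) hq hq1 z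
    rw [h0, mul_zero, norm_le_zero_iff, sub_eq_zero] at h1
    exact hne (h1 ▸ hEx₀)
  set ρ := √(radSq q x₀ z)
  have hρlt : ρ < ρ₀ := hz.trans_le (mul_le_of_le_one_right hρ₀.le
    (Real.exp_le_one_iff.2 (by rw [neg_nonpos]; positivity)))
  set w := Real.exp (A * ρ) / ρ with hw
  set w₀ := Real.exp (A * ρ₀) / ρ₀ with hw₀
  have hw₀pos : 0 < w₀ := by positivity
  have hww : 1 < w / w₀ := by
    rw [one_lt_div hw₀pos, hw, hw₀, div_lt_div_iff₀ hρ₀ hρz]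
    have : Real.exp (A * ρ₀) * ρ < ρ₀ := by
      calc _ < Real.exp (A * ρ₀) * (ρ₀ * Real.exp (-(A * ρ₀))) := by gcongr
        _ = ρ₀ := by rw [mul_left_comm, ← Real.exp_add]; simp
    exact this.trans_le (le_mul_of_one_le_left hρ₀.le (Real.one_le_exp (by positivity)))
  obtain ⟨n, hn, hnN⟩ := (((tendsto_pow_atTop_atTop_of_one_lt hww).eventually_gt_atTop
    (M / E z)).and (eventually_ge_atTop N)).exists
  obtain ⟨y, hy, hle⟩ := exists_boundary_of_no_interior_max hq hq1 hE (hv (n + 1))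
    (hmax n hnN) hρz hρlt hEz
  have hyM : E y ≤ M := hM ⟨y, hy.le, rfl⟩
  rw [div_lt_iff₀ hEz, div_pow, div_mul_eq_mul_div, lt_div_iff₀ (by positivity)] at hn
  have : E y * w₀ ^ n ≤ M * w₀ ^ n := by gcongr
  linarith

end Carleman

lemma ContinuousAt.eventually_abs_le {f : ℝ × ℝ → ℝ} {x : ℝ × ℝ} (hf : ContinuousAt f x) :
    ∀ᶠ M in atTop, ∀ᶠ y in 𝓝 x, |f y| ≤ M := by
  filter_upwards [eventually_gt_atTop |f x|] with M hM
  exact (hf.abs.eventually_lt_const hM).mono fun _ h => h.le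

/-- Strong unique continuation for the gradient of a translating graph: if the gradient agrees to
infinite order with `(0, k)` at a point, it is equal to `(0, k)` nearby. -/
lemma eventually_gradDefect_eq_zero {Ω : Set (ℝ × ℝ)} {u : ℝ × ℝ → ℝ} {x₀ : ℝ × ℝ} {c k : ℝ}
    (hΩ : IsOpen Ω) (hu : ContDiffOn ℝ (⊤ : ℕ∞) u Ω) (hx₀ : x₀ ∈ Ω)
    (hpde : ∀ y ∈ Ω, TranslatorEq c k u y) (hvs : ∀ N, VanishesTo N (pds u) x₀)
    (hvt : ∀ N, VanishesTo N (fun y => pdt u y - k) x₀) :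
    ∀ᶠ y in 𝓝 x₀, gradDefect k u y = 0 := by
  have hs := smooth_pds hΩ hu
  have ht := smooth_pdt hΩ hu
  have hr : ContDiffOn ℝ (⊤ : ℕ∞) (fun y => pdt u y - k) Ω := ht.sub contDiffOn_const
  obtain ⟨q, hq, hqk⟩ : ∃ q : ℝ, 0 < q ∧ q ^ 2 * (1 + k ^ 2) = 1 :=
    ⟨(√(1 + k ^ 2))⁻¹, by positivity, by
      rw [inv_pow, Real.sq_sqrt (by positivity), inv_mul_cancel₀ (by positivity)]⟩
  have hq1 : q ≤ 1 := by nlinarith [sq_nonneg (q * k)]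
  have cont : ∀ {f : ℝ × ℝ → ℝ}, ContDiffOn ℝ (⊤ : ℕ∞) f Ω → ContinuousAt f x₀ := fun hf =>
    hf.continuousOn.continuousAt (hΩ.mem_nhds hx₀)
  have cs := cont hs
  have ct := cont ht
  have css := cont (smooth_pds hΩ hs)
  have cst := cont (smooth_pdt hΩ hs)
  have ctt := cont (smooth_pdt hΩ ht)
  have cE := cont (smooth_gradDefect (k := k) hΩ hu)
  have htx : pdt u x₀ = k := sub_eq_zero.1 (hvt 1).1
  have hkx : 1 + k * pdt u x₀ ≠ 0 := by rw [htx]; nlinarith [sq_nonneg k]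
  have ck : ContinuousAt (fun y => 1 + k * pdt u y) x₀ := by fun_prop
  have hkne : ∀ᶠ y in 𝓝 x₀, 1 + k * pdt u y ≠ 0 := ck.eventually_ne hkx
  have cc : ContinuousAt (fun y => c / (1 + k * pdt u y)) x₀ := by fun_prop (disch := exact hkx)
  obtain ⟨M, hM1, hM2, hM3, hM4, hM5, hM6⟩ := (cs.eventually_abs_le.and
    (ct.eventually_abs_le.and
    ((show ContinuousAt (fun y => pds (pds u) y * pdt (pdt u) y - pdt (pds u) y ^ 2) x₀ by
      fun_prop).eventually_abs_le.and
    (cc.eventually_abs_le.and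
    ((show ContinuousAt (fun y => gradDefect k u y + 2 * (1 + k * pdt u y) ^ 2) x₀ by
      fun_prop).eventually_abs_le.and
    (show ContinuousAt (fun y => |2 * pds u y * pds (pds u) y + 2 * pdt u y * pdt (pds u) y|
      + |2 * pds u y * pdt (pds u) y + 2 * pdt u y * pdt (pdt u) y|) x₀ by
      fun_prop).eventually_abs_le))))).exists
  have lin : ∀ {f : ℝ × ℝ → ℝ}, ContDiffOn ℝ (⊤ : ℕ∞) f Ω → VanishesTo 1 f x₀ →
      ∀ᶠ B in atTop, ∀ᶠ y in 𝓝 x₀, |f y| ≤ B * √(radSq q x₀ y) := by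
    intro f hf hv
    obtain ⟨C, hC0, hC⟩ := hv.bound hΩ hx₀ hf
    filter_upwards [eventually_ge_atTop (C * q⁻¹)] with B hB
    filter_upwards [hC] with y hy
    calc |f y| ≤ C * (q⁻¹ * √(radSq q x₀ y)) := by
          refine hy.trans ?_
          rw [pow_one]
          gcongr
          exact norm_le_of_sqrt_radSq hq hq1 y
      _ = C * q⁻¹ * √(radSq q x₀ y) := by ring
      _ ≤ _ := by gcongr
  obtain ⟨B, hB1, hB2, hB3, hB4, hB5, hB6⟩ := ((lin hs (hvs 1)).and ((lin hr (hvt 1)).and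
    (cs.eventually_abs_le.and (ct.eventually_abs_le.and ((eventually_ge_atTop |k|).and
    (show ContinuousAt (fun y => c * (1 + pds u y ^ 2 + pdt u y ^ 2)) x₀ by
      fun_prop).eventually_abs_le))))).exists
  obtain ⟨C, hC⟩ : ∃ C, C = 2 * M + 2 * M ^ 2 * (1 + M ^ 2) * (1 + M) := ⟨_, rfl⟩
  obtain ⟨A, hA⟩ : ∃ A, A = 20 * B ^ 2 + 2 * B + 2 * C + 1 := ⟨_, rfl⟩
  have hM0 : 0 ≤ M := (abs_nonneg _).trans hM1.self_of_nhds
  have hB0 : 0 ≤ B := (abs_nonneg _).trans hB5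
  have hC0 : 0 ≤ C := by rw [hC]; positivity
  have hA0 : 0 ≤ A := by rw [hA]; positivity
  set L := 1 + (20 * B ^ 2 + 2 * B + 2 * C) * A with hL
  have hLpos : 0 < L := by positivity
  obtain ⟨δ, hδ, H⟩ := exists_radius_of_eventually hq hq1 ((hΩ.eventually_mem hx₀).and
    (hkne.and (hM1.and (hM2.and (hM3.and (hM4.and (hM5.and (hM6.and (hB1.and (hB2.and (hB3.and
    (hB4.and hB6))))))))))))
  obtain ⟨ρ₀, hρ₀, hρδ, hρL⟩ : ∃ ρ₀ > 0, ρ₀ < δ ∧ ρ₀ * L ≤ 1 :=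
    ⟨min (δ / 2) L⁻¹, by positivity, (min_le_left _ _).trans_lt (by linarith),
      (mul_le_mul_of_nonneg_right (min_le_right _ _) hLpos.le).trans
        (inv_mul_cancel₀ hLpos.ne').le⟩
  obtain ⟨N, hN⟩ := exists_nat_gt C
  refine eventually_eq_zero_of_no_interior_max (A := A) (N := N) hq hq1 hA0 hρ₀
    ((smooth_gradDefect hΩ hu).continuousOn.mono fun y hy =>
      (H y (lt_of_le_of_lt hy hρδ)).1) (gradDefect_nonneg k u) ?_ ?_
  · intro n
    have h1 : VanishesTo n (fun y => (1 + k ^ 2) * (pds u y * pds u y)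
        + (pdt u y - k) * (pdt u y - k)) x₀ :=
      (((hvs n).mul hΩ hx₀ hs hs).const_mul hΩ hx₀ (hs.mul hs) _).add hΩ hx₀
        (contDiffOn_const.mul (hs.mul hs)) (hr.mul hr) ((hvt n).mul hΩ hx₀ hr hr)
    obtain ⟨K, hK0, hK⟩ := h1.bound hΩ hx₀ ((contDiffOn_const.mul (hs.mul hs)).add (hr.mul hr))
    refine ⟨K * q⁻¹ ^ n, hK.mono fun y hy => ?_⟩
    have e : gradDefect k u y = (1 + k ^ 2) * (pds u y * pds u y)
        + (pdt u y - k) * (pdt u y - k) := by unfold gradDefect; ring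
    rw [e, mul_assoc, ← mul_pow]
    refine (le_abs_self _).trans (hy.trans ?_)
    gcongr
    exact norm_le_of_sqrt_radSq hq hq1 y
  · intro n hn x hx hxρ hEx
    obtain ⟨h0, h1, h2, h3, h4, h5, h6, h7, h8, h9, h10, h11, h12⟩ := H x (hxρ.trans hρδ)
    refine not_isLocalMax_log_gradDefect hΩ hu h0 hpde h1 h2 h3 h4 h5
      ((le_abs_self _).trans h6) ((le_abs_self _).trans h7) hEx hx hqk h8 h9 h10 h11 hB5 h12 hC
      (hN.trans_le (by exact_mod_cast hn)) hA ?_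
    exact (mul_le_mul_of_nonneg_right hxρ.le hLpos.le).trans hρL

section Rigidity

variable {Ω : Set (ℝ × ℝ)} {u : ℝ × ℝ → ℝ} {x₀ : ℝ × ℝ} {c k : ℝ}

lemma gradDefect_eq_zero_iff (k : ℝ) (u : ℝ × ℝ → ℝ) (y : ℝ × ℝ) :
    gradDefect k u y = 0 ↔ pds u y = 0 ∧ pdt u y - k = 0 := by
  unfold gradDefect
  rw [add_eq_zero_iff_of_nonneg (by positivity) (by positivity), mul_eq_zero_iff_left
    (by positivity), sq_eq_zero_iff, sq_eq_zero_iff, sub_eq_zero, sub_eq_zero, eq_comm (a := k)]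

lemma gradient_eq_of_vanishesTo (hΩ : IsOpen Ω) (hΩc : IsPreconnected Ω)
    (hu : ContDiffOn ℝ (⊤ : ℕ∞) u Ω) (hx₀ : x₀ ∈ Ω)
    (hpde : ∀ y ∈ Ω, TranslatorEq c k u y) (hvs : ∀ N, VanishesTo N (pds u) x₀)
    (hvt : ∀ N, VanishesTo N (fun y => pdt u y - k) x₀) :
    ∀ y ∈ Ω, pds u y = 0 ∧ pdt u y = k := by
  have hs := smooth_pds hΩ hu
  have hr : ContDiffOn ℝ (⊤ : ℕ∞) (fun y => pdt u y - k) Ω :=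
    (smooth_pdt hΩ hu).sub contDiffOn_const
  set Z : Set (ℝ × ℝ) := {y | y ∈ Ω ∧ (∀ N, VanishesTo N (pds u) y) ∧
    ∀ N, VanishesTo N (fun y => pdt u y - k) y} with hZ
  have hZo : IsOpen Z := by
    rw [isOpen_iff_eventually]
    rintro y ⟨hy, h1, h2⟩
    filter_upwards [hΩ.eventually_mem hy, eventually_eventually_nhds.2
      (eventually_gradDefect_eq_zero hΩ hu hy hpde h1 h2)] with z hz hE
    refine ⟨hz, fun N => (vanishesTo_zero N).congr ?_, fun N => (vanishesTo_zero N).congr ?_⟩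
    · exact hE.mono fun a ha => ((gradDefect_eq_zero_iff k u a).1 ha).1.symm
    · exact hE.mono fun a ha => ((gradDefect_eq_zero_iff k u a).1 ha).2.symm
  have hsub : Ω ⊆ Z := by
    refine hΩc.subset_of_closure_inter_subset hZo ⟨x₀, hx₀, hx₀, hvs, hvt⟩ ?_
    rintro y ⟨hy, hyΩ⟩
    exact ⟨hyΩ,
      fun N => .of_mem_closure hΩ hyΩ hs (closure_mono
        (show Z ⊆ {y ∈ Ω | VanishesTo N (pds u) y} from fun a ha => ⟨ha.1, ha.2.1 N⟩) hy),
      fun N => .of_mem_closure hΩ hyΩ hr (closure_mono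
        (show Z ⊆ {y ∈ Ω | VanishesTo N (fun y => pdt u y - k) y} from
          fun a ha => ⟨ha.1, ha.2.2 N⟩) hy)⟩
  exact fun y hy => ⟨((hsub hy).2.1 1).1, sub_eq_zero.1 ((hsub hy).2.2 1).1⟩

lemma exists_affine_of_gradient_eq (hΩ : IsOpen Ω) (hΩc : IsPreconnected Ω)
    (hu : ContDiffOn ℝ (⊤ : ℕ∞) u Ω) (h : ∀ y ∈ Ω, pds u y = 0 ∧ pdt u y = k) :
    ∃ b, ∀ y ∈ Ω, u y = k * y.2 + b := by
  have hd : ∀ y ∈ Ω, HasFDerivAt (fun y => u y - k * y.2)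
      (fderiv ℝ u y - k • ContinuousLinearMap.snd ℝ ℝ ℝ) y := fun y hy =>
    (smooth_hasFDerivAt hΩ hu hy).sub (hasFDerivAt_snd.const_mul k)
  obtain ⟨b, hb⟩ := hΩ.exists_is_const_of_fderiv_eq_zero (𝕜 := ℝ) hΩc
    (fun y hy => (hd y hy).differentiableAt.differentiableWithinAt) (fun y hy => by
      rw [(hd y hy).fderiv]
      ext
      · simpa [pds] using (h y hy).1
      · simpa [pdt, sub_eq_zero] using (h y hy).2)
  exact ⟨b, fun y hy => by linarith [hb y hy]⟩

end Rigidity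

section Graph

variable {θ : ℝ} {Ω : Set (ℝ × ℝ)} {u : ℝ × ℝ → ℝ} {S : Set E3}

lemma graphPtθ_zero (θ : ℝ) (u : ℝ × ℝ → ℝ) (p : ℝ × ℝ) : graphPtθ θ u p 0 = p.1 := by
  simp [graphPtθ, e1, e2, e3, bθ, vθ]

lemma graphPtθ_one (θ : ℝ) (u : ℝ × ℝ → ℝ) (p : ℝ × ℝ) :
    graphPtθ θ u p 1 = Real.cos θ * u p - Real.sin θ * p.2 := by
  simp [graphPtθ, e1, e2, e3, bθ, vθ]; ring

lemma graphPtθ_two (θ : ℝ) (u : ℝ × ℝ → ℝ) (p : ℝ × ℝ) :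
    graphPtθ θ u p 2 = Real.cos θ * p.2 + Real.sin θ * u p := by
  simp [graphPtθ, e1, e2, e3, bθ, vθ]; ring

/-- The parameter of the point `q` of a graph over the basis `(e₁, b_θ, v_θ)`. -/
def paramθ (θ : ℝ) (q : E3) : ℝ × ℝ := (q 0, Real.cos θ * q 2 - Real.sin θ * q 1)

lemma paramθ_graphPtθ (θ : ℝ) (u : ℝ × ℝ → ℝ) (p : ℝ × ℝ) : paramθ θ (graphPtθ θ u p) = p := by
  ext
  · simp [paramθ, graphPtθ_zero]
  · simp only [paramθ, graphPtθ_one, graphPtθ_two]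
    linear_combination p.2 * Real.cos_sq_add_sin_sq θ

lemma mem_graph_iff (hgraph : IsTranslatingGraph e1 (bθ θ) (vθ θ) Ω u S) {q : E3} :
    q ∈ S ↔ ∃ p ∈ Ω, graphPtθ θ u p = q := by
  rw [hgraph.graph_eq]
  simp only [Set.mem_ofPred_eq, graphPtθ, eq_comm]

lemma graph_pde (hgraph : IsTranslatingGraph e1 (bθ θ) (vθ θ) Ω u S) {y : ℝ × ℝ} (hy : y ∈ Ω) :
    (1 + pdt u y ^ 2) * pds (pds u) y - 2 * pds u y * pdt u y * pdt (pds u) y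
      + (1 + pds u y ^ 2) * pdt (pdt u) y =
      (1 + pds u y ^ 2 + pdt u y ^ 2) * (Real.sin θ - Real.cos θ * pdt u y) := by
  have h1 : ⟪e3, vθ θ⟫ = Real.sin θ := by
    simp [e2, e3, vθ, inner_add_right, inner_smul_right, EuclideanSpace.inner_single_left]
  have h2 : ⟪e3, e1⟫ = 0 := by simp [e1, e3, EuclideanSpace.inner_single_left]
  have h3 : ⟪e3, bθ θ⟫ = Real.cos θ := by
    simp [e2, e3, bθ, inner_sub_right, inner_smul_right, EuclideanSpace.inner_single_left]
  have := hgraph.pde y hy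
  rw [h1, h2, h3] at this
  linear_combination this

lemma not_affine_graph (hgraph : IsTranslatingGraph e1 (bθ θ) (vθ θ) Ω u S)
    (hcomplete : IsClosed S) {w : ℝ} (hslab : S ⊆ {q : E3 | |q 0| ≤ w}) (k b : ℝ) :
    ¬ ∀ y ∈ Ω, u y = k * y.2 + b := by
  intro h
  set ψ : ℝ × ℝ → E3 := graphPtθ θ fun y => k * y.2 + b with hψ
  have hψc : Continuous ψ := by unfold ψ graphPtθ; fun_prop
  have hψΩ : ∀ y ∈ Ω, graphPtθ θ u y = ψ y := fun y hy => by
    simp only [hψ, graphPtθ, h y hy]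
  have hpre : ψ ⁻¹' S = Ω := by
    ext y
    rw [Set.mem_preimage, mem_graph_iff hgraph]
    constructor
    · rintro ⟨p, hp, e⟩
      have := congrArg (paramθ θ) e
      rw [hψ, paramθ_graphPtθ, paramθ_graphPtθ] at this
      exact this ▸ hp
    · exact fun hy => ⟨y, hy, hψΩ y hy⟩
  have hΩ : Ω = Set.univ := IsClopen.eq_univ ⟨hpre ▸ hcomplete.preimage hψc, hgraph.isOpen_dom⟩
    hgraph.isConnected_dom.nonempty
  have hmem : ψ (|w| + 1, 0) ∈ S := by
    have : ((|w| + 1, 0) : ℝ × ℝ) ∈ Ω := hΩ ▸ Set.mem_univ _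
    rwa [← hpre] at this
  have := hslab hmem
  rw [Set.mem_ofPred_eq, hψ, graphPtθ_zero] at this
  have h2 := le_abs_self (|w| + 1)
  linarith [le_abs_self w]

/-- The height `⟨·, e₂⟩` on the graph, as a function of the parameter. -/
def heightθ (θ : ℝ) (u : ℝ × ℝ → ℝ) (p : ℝ × ℝ) : ℝ := Real.cos θ * u p - Real.sin θ * p.2

lemma smooth_heightθ (hu : ContDiffOn ℝ (⊤ : ℕ∞) u Ω) :
    ContDiffOn ℝ (⊤ : ℕ∞) (heightθ θ u) Ω :=
  (contDiffOn_const.mul hu).sub (by fun_prop)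

lemma dirD_heightθ (hΩ : IsOpen Ω) (hu : ContDiffOn ℝ (⊤ : ℕ∞) u Ω) {y : ℝ × ℝ} (hy : y ∈ Ω)
    (v : ℝ × ℝ) : dirD v (heightθ θ u) y = Real.cos θ * dirD v u y - Real.sin θ * v.2 := by
  refine ((((smooth_hasFDerivAt hΩ hu hy).const_mul (Real.cos θ)).sub
    ((hasFDerivAt_snd (𝕜 := ℝ) (E := ℝ) (F := ℝ) (p := y)).const_mul (Real.sin θ))).dirD_eq
      v).trans ?_
  simp [dirD]

lemma dirD_dirD_heightθ (hΩ : IsOpen Ω) (hu : ContDiffOn ℝ (⊤ : ℕ∞) u Ω) {y : ℝ × ℝ} (hy : y ∈ Ω)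
    (v w : ℝ × ℝ) : dirD v (dirD w (heightθ θ u)) y = Real.cos θ * dirD v (dirD w u) y := by
  rw [dirD_congr (eventuallyEq_of_eqOn hΩ hy fun z hz => dirD_heightθ (θ := θ) hΩ hu hz w) v]
  refine ((((smooth_hasFDerivAt hΩ (smooth_dirD hΩ hu w) hy).const_mul (Real.cos θ)).sub_const
    _).dirD_eq v).trans ?_
  simp [dirD]

lemma ell_heightθ (hgraph : IsTranslatingGraph e1 (bθ θ) (vθ θ) Ω u S) {y : ℝ × ℝ} (hy : y ∈ Ω) :
    ell (pds u y) (pdt u y) (Real.cos θ * (1 + pds u y ^ 2 + pdt u y ^ 2)) (heightθ θ u) y = 0 := by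
  have hp := graph_pde hgraph hy
  simp only [ell, pds_eq_dirD, pdt_eq_dirD] at hp ⊢
  rw [dirD_dirD_heightθ hgraph.isOpen_dom hgraph.smooth hy,
    dirD_dirD_heightθ hgraph.isOpen_dom hgraph.smooth hy,
    dirD_dirD_heightθ hgraph.isOpen_dom hgraph.smooth hy,
    dirD_heightθ hgraph.isOpen_dom hgraph.smooth hy]
  linear_combination Real.cos θ * hp

/-- From every point of the graph the height strictly increases along some line segment. -/
lemma exists_increasing_direction (hgraph : IsTranslatingGraph e1 (bθ θ) (vθ θ) Ω u S)
    (hcomplete : IsClosed S) {w : ℝ} (hslab : S ⊆ {q : E3 | |q 0| ≤ w}) {x : ℝ × ℝ} (hx : x ∈ Ω) :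
    ∃ v, ∀ᶠ s : ℝ in 𝓝[>] 0, heightθ θ u x < heightθ θ u (x + s • v) := by
  have hΩ := hgraph.isOpen_dom
  have hu := hgraph.smooth
  have hs := smooth_pds hΩ hu
  have ht := smooth_pdt hΩ hu
  by_contra! hno
  set c := Real.cos θ with hc
  set σ := Real.sin θ with hσ
  have hcσ : c ^ 2 + σ ^ 2 = 1 := Real.cos_sq_add_sin_sq θ
  set h : ℝ × ℝ → ℝ := fun y => heightθ θ u y + -heightθ θ u x with hh
  have hhs : ContDiffOn ℝ (⊤ : ℕ∞) h Ω := (smooth_heightθ hu).add contDiffOn_const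
  have hdir : ∀ v, dirD v h = dirD v (heightθ θ u) := fun v => by
    ext y
    simp only [hh, dirD, fderiv_add_const]
  have hds : ∀ y ∈ Ω, pds h y = c * pds u y := fun y hy => by
    rw [pds_eq_dirD, hdir, dirD_heightθ hΩ hu hy]; simp [← pds_eq_dirD, hc]
  have hdt : ∀ y ∈ Ω, pdt h y = c * pdt u y - σ := fun y hy => by
    rw [pdt_eq_dirD, hdir, dirD_heightθ hΩ hu hy]; simp [← pdt_eq_dirD, hc, hσ]
  have hinc : ∀ v, ¬ ∀ᶠ s : ℝ in 𝓝[>] 0, 0 < h (x + s • v) := fun v hv =>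
    hno v (hv.mono fun s hs => by simp only [hh] at hs; linarith)
  have hgrad : ∀ v, dirD v h x ≤ 0 := by
    intro v
    by_contra! hpos
    exact hinc v (eventually_pos_of_dirD_iterate hΩ hx hhs (m := 1) (v := v)
      ⟨by simp [hh], trivial, trivial⟩ hpos)
  have hgrad0 : ∀ v, dirD v h x = 0 := by
    intro v
    refine le_antisymm (hgrad v) ?_
    have := hgrad (-v)
    simp only [dirD, map_neg] at this ⊢
    linarith
  have hp0 : c * pds u x = 0 := (hds x hx).symm.trans (hgrad0 _)
  have hr0 : c * pdt u x - σ = 0 := (hdt x hx).symm.trans (hgrad0 _)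
  have hc0 : c ≠ 0 := by
    intro h0
    rw [h0] at hr0 hcσ
    nlinarith
  have hpx : pds u x = 0 := by simpa [hc0] using hp0
  have hrx : pdt u x = σ / c := by field_simp; linarith
  have hvan : ∀ N, VanishesTo N h x := by
    intro N
    refine vanishesTo_of_not_increasing (q := c) (a := fun y => 1 + pdt u y ^ 2)
      (b := fun y => -2 * pds u y * pdt u y) (c := fun y => 1 + pds u y ^ 2)
      (d := fun y => c * (1 + pds u y ^ 2 + pdt u y ^ 2)) hΩ hx hhs hc0
      (contDiffOn_const.add (ht.pow 2)) ((contDiffOn_const.mul hs).mul ht)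
      (contDiffOn_const.add (hs.pow 2))
      (contDiffOn_const.mul ((contDiffOn_const.add (hs.pow 2)).add (ht.pow 2)))
      ?_ (by simp [hpx]) (by simp [hpx]) ?_ (by simp [hh]) (hgrad0 _) (hgrad0 _) hinc N
    · simp only [hrx]
      field_simp
      linarith
    · intro y hy
      have := ell_heightθ hgraph hy
      simp only [ell, pds_eq_dirD, pdt_eq_dirD, hdir] at this ⊢
      linear_combination this
  have hpde : ∀ y ∈ Ω, TranslatorEq c (σ / c) u y := fun y hy => by
    have := graph_pde hgraph hy
    unfold TranslatorEq
    have e : c * (σ / c - pdt u y) = σ - c * pdt u y := by field_simp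
    rw [this, e]
  have hgr := gradient_eq_of_vanishesTo hΩ hgraph.isConnected_dom.isPreconnected hu hx hpde
    (fun N => (((hvan (N + 1)).2.1).const_mul hΩ hx (smooth_pds hΩ hhs) c⁻¹).congr
      (eventuallyEq_of_eqOn hΩ hx fun y hy => by rw [hds y hy]; field_simp))
    (fun N => (((hvan (N + 1)).2.2).const_mul hΩ hx (smooth_pdt hΩ hhs) c⁻¹).congr
      (eventuallyEq_of_eqOn hΩ hx fun y hy => by rw [hdt y hy]; field_simp))
  obtain ⟨b, hb⟩ := exists_affine_of_gradient_eq hΩ hgraph.isConnected_dom.isPreconnected hu hgr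
  exact not_affine_graph hgraph hcomplete hslab _ _ hb

end Graph

section Barrier

variable {θ : ℝ} {Ω : Set (ℝ × ℝ)} {u : ℝ × ℝ → ℝ} {S : Set E3}

/-- The convex function `e^{-z} + z`. -/
def expBarrier (z : ℝ) : ℝ := Real.exp (-z) + z

lemma contDiff_expBarrier : ContDiff ℝ (⊤ : ℕ∞) expBarrier := by unfold expBarrier; fun_prop

lemma hasDerivAt_expBarrier (z : ℝ) : HasDerivAt expBarrier (1 - Real.exp (-z)) z := by
  have := (hasDerivAt_neg z).exp.add (hasDerivAt_id z)
  refine this.congr_deriv ?_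
  ring

lemma hasDerivAt_one_sub_exp_neg (z : ℝ) :
    HasDerivAt (fun z => 1 - Real.exp (-z)) (Real.exp (-z)) z := by
  refine ((hasDerivAt_neg z).exp.const_sub 1).congr_deriv ?_
  ring

lemma one_le_expBarrier (z : ℝ) : 1 ≤ expBarrier z := by
  unfold expBarrier; linarith [Real.add_one_le_exp (-z)]

lemma abs_le_expBarrier (z : ℝ) : |z| ≤ expBarrier z := by
  unfold expBarrier
  rcases le_total 0 z with h | h
  · rw [abs_of_nonneg h]
    linarith [Real.exp_pos (-z)]
  · rw [abs_of_nonpos h]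
    nlinarith [Real.quadratic_le_exp_of_nonneg (neg_nonneg.2 h), sq_nonneg (z + 1)]

/-- The coordinate `⟨·, e₃⟩` on the graph, as a function of the parameter. -/
def depthθ (θ : ℝ) (u : ℝ × ℝ → ℝ) (p : ℝ × ℝ) : ℝ := Real.cos θ * p.2 + Real.sin θ * u p

lemma smooth_depthθ (hu : ContDiffOn ℝ (⊤ : ℕ∞) u Ω) :
    ContDiffOn ℝ (⊤ : ℕ∞) (depthθ θ u) Ω :=
  ContDiffOn.add (by fun_prop) (contDiffOn_const.mul hu)

lemma dirD_snd (v x : ℝ × ℝ) : dirD v (fun y => y.2) x = v.2 := by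
  simpa using dirD_affine 0 1 0 v x

lemma dirD_fst (v x : ℝ × ℝ) : dirD v (fun y => y.1) x = v.1 := by
  simpa using dirD_affine 1 0 0 v x

lemma ell_snd (p r d : ℝ) (x : ℝ × ℝ) : ell p r d (fun y => y.2) x = d := by
  have h : ∀ v, dirD v (fun y : ℝ × ℝ => y.2) = fun _ => v.2 := fun v => funext (dirD_snd v)
  simp [ell, pds_eq_dirD, pdt_eq_dirD, h, dirD_const]

lemma ell_fst (p r d : ℝ) (x : ℝ × ℝ) : ell p r d (fun y => y.1) x = 0 := by
  have h : ∀ v, dirD v (fun y : ℝ × ℝ => y.1) = fun _ => v.1 := fun v => funext (dirD_fst v)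
  simp [ell, pds_eq_dirD, pdt_eq_dirD, h, dirD_const]

lemma dirD_depthθ (hΩ : IsOpen Ω) (hu : ContDiffOn ℝ (⊤ : ℕ∞) u Ω) {y : ℝ × ℝ} (hy : y ∈ Ω)
    (v : ℝ × ℝ) : dirD v (depthθ θ u) y = Real.cos θ * v.2 + Real.sin θ * dirD v u y := by
  have h2 : ContDiffOn ℝ (⊤ : ℕ∞) (fun y : ℝ × ℝ => y.2) Ω := by fun_prop
  have := dirD_add hΩ (contDiffOn_const (c := Real.cos θ) |>.mul h2)
    (contDiffOn_const (c := Real.sin θ) |>.mul hu) hy v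
  rwa [dirD_const_mul hΩ h2 hy, dirD_const_mul hΩ hu hy, dirD_snd] at this

lemma ell_depthθ (hgraph : IsTranslatingGraph e1 (bθ θ) (vθ θ) Ω u S) {y : ℝ × ℝ} (hy : y ∈ Ω) :
    ell (pds u y) (pdt u y) (Real.cos θ * (1 + pds u y ^ 2 + pdt u y ^ 2)) (depthθ θ u) y =
      1 + pds u y ^ 2 + pdt u y ^ 2 := by
  have hΩ := hgraph.isOpen_dom
  have hu := hgraph.smooth
  have h2 : ContDiffOn ℝ (⊤ : ℕ∞) (fun y : ℝ × ℝ => y.2) Ω := by fun_prop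
  have hp := graph_pde hgraph hy
  have := ell_add hΩ (contDiffOn_const (c := Real.cos θ) |>.mul h2)
    (contDiffOn_const (c := Real.sin θ) |>.mul hu) hy (pds u y) (pdt u y)
    (Real.cos θ * (1 + pds u y ^ 2 + pdt u y ^ 2))
  rw [ell_const_mul hΩ h2 hy, ell_const_mul hΩ hu hy, ell_snd] at this
  refine Eq.trans this ?_
  unfold ell
  linear_combination Real.sin θ * hp +
    (1 + pds u y ^ 2 + pdt u y ^ 2) * Real.cos_sq_add_sin_sq θ

/-- The barrier `e^{-z} + z - (x² + y²)` on the graph, as a function of the parameter. -/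
def barrierθ (θ : ℝ) (u : ℝ × ℝ → ℝ) (p : ℝ × ℝ) : ℝ :=
  expBarrier (depthθ θ u p) + -1 * (p.1 ^ 2 + heightθ θ u p ^ 2)

lemma smooth_barrierθ (hu : ContDiffOn ℝ (⊤ : ℕ∞) u Ω) :
    ContDiffOn ℝ (⊤ : ℕ∞) (barrierθ θ u) Ω :=
  (contDiff_expBarrier.comp_contDiffOn (smooth_depthθ hu)).add
    (contDiffOn_const.mul (ContDiffOn.add (by fun_prop) ((smooth_heightθ hu).pow 2)))

lemma ell_sq {h : ℝ × ℝ → ℝ} (hΩ : IsOpen Ω) (hh : ContDiffOn ℝ (⊤ : ℕ∞) h Ω) {x : ℝ × ℝ}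
    (hx : x ∈ Ω) (p r d : ℝ) : ell p r d (fun y => h y ^ 2) x =
      2 * h x * ell p r d h x + 2 * graphQuad p r (pds h x) (pdt h x) :=
  ell_comp (φ := fun z => z ^ 2) (φ₁ := fun z => 2 * z) hΩ hh hx
    (fun y _ => by simpa using hasDerivAt_pow 2 (h y))
    (by simpa using (hasDerivAt_id (h x)).const_mul 2) p r d

lemma ell_barrierθ_neg (hgraph : IsTranslatingGraph e1 (bθ θ) (vθ θ) Ω u S) {y : ℝ × ℝ}
    (hy : y ∈ Ω) :
    ell (pds u y) (pdt u y) (Real.cos θ * (1 + pds u y ^ 2 + pdt u y ^ 2)) (barrierθ θ u) y <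
      0 := by
  have hΩ := hgraph.isOpen_dom
  have hu := hgraph.smooth
  have hz := smooth_depthθ (θ := θ) hu
  have hh := smooth_heightθ (θ := θ) hu
  have h1 : ContDiffOn ℝ (⊤ : ℕ∞) (fun y : ℝ × ℝ => y.1) Ω := by fun_prop
  have hcs := Real.cos_sq_add_sin_sq θ
  have hLz := ell_depthθ hgraph hy
  have hLh := ell_heightθ hgraph hy
  have hgz1 : pds (depthθ θ u) y = Real.sin θ * pds u y := by
    rw [pds_eq_dirD, dirD_depthθ hΩ hu hy]; simp [pds_eq_dirD]
  have hgz2 : pdt (depthθ θ u) y = Real.cos θ + Real.sin θ * pdt u y := by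
    rw [pdt_eq_dirD, dirD_depthθ hΩ hu hy]; simp [pdt_eq_dirD]
  have hgh1 : pds (heightθ θ u) y = Real.cos θ * pds u y := by
    rw [pds_eq_dirD, dirD_heightθ hΩ hu hy]; simp [pds_eq_dirD]
  have hgh2 : pdt (heightθ θ u) y = Real.cos θ * pdt u y - Real.sin θ := by
    rw [pdt_eq_dirD, dirD_heightθ hΩ hu hy]; simp [pdt_eq_dirD]
  have hg11 : pds (fun y : ℝ × ℝ => y.1) y = 1 := dirD_fst _ _
  have hg12 : pdt (fun y : ℝ × ℝ => y.1) y = 0 := dirD_fst _ _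
  have key : ∀ p r d : ℝ, ell p r d (barrierθ θ u) y =
      ell p r d (fun y => expBarrier (depthθ θ u y)) y +
        -1 * (ell p r d (fun y => y.1 ^ 2) y + ell p r d (fun y => heightθ θ u y ^ 2) y) := by
    intro p r d
    rw [← ell_add hΩ (h1.pow 2) (hh.pow 2) hy, ← ell_const_mul hΩ ((h1.pow 2).add (hh.pow 2)) hy]
    exact ell_add hΩ (contDiff_expBarrier.comp_contDiffOn hz)
      (contDiffOn_const.mul ((h1.pow 2).add (hh.pow 2))) hy p r d
  rw [key, ell_sq hΩ h1 hy, ell_sq hΩ hh hy, ell_comp hΩ hz hy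
    (fun _ _ => hasDerivAt_expBarrier _) (hasDerivAt_one_sub_exp_neg _), hLz, hLh, ell_fst,
    hgz1, hgz2, hgh1, hgh2, hg11, hg12]
  have hE := Real.exp_pos (-depthθ θ u y)
  set E := Real.exp (-depthθ θ u y)
  set p := pds u y
  set r := pdt u y
  set c := Real.cos θ
  set s := Real.sin θ
  have e1 : graphQuad p r (s * p) (c + s * r) = (1 + p ^ 2 + r ^ 2) - (s - c * r) ^ 2 := by
    unfold graphQuad
    linear_combination (p ^ 2 + r ^ 2 + 1) * hcs
  have e2 : graphQuad p r 1 0 + graphQuad p r (c * p) (c * r - s) =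
      (1 + p ^ 2 + r ^ 2) + ((1 + r ^ 2) - (c + s * r) ^ 2) := by
    unfold graphQuad
    linear_combination (p ^ 2 + r ^ 2 + 1) * hcs
  have e3 : (c + s * r) ^ 2 ≤ 1 + r ^ 2 := by
    nlinarith [sq_nonneg (s - c * r)]
  rw [e1]
  nlinarith [mul_nonneg hE.le (sq_nonneg (s - c * r)), sq_nonneg p, sq_nonneg r]

end Barrier

section Components

variable {θ : ℝ} {Ω : Set (ℝ × ℝ)} {u : ℝ × ℝ → ℝ} {S : Set E3}

lemma isClosed_connectedComponentIn {X : Type*} [TopologicalSpace X] {F : Set X} (hF : IsClosed F)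
    (x : X) : IsClosed (connectedComponentIn F x) := by
  by_cases hx : x ∈ F
  · rw [connectedComponentIn_eq_image hx]
    exact hF.isClosedEmbedding_subtypeVal.isClosedMap _ isClosed_connectedComponent
  · rw [connectedComponentIn_eq_empty hx]
    exact isClosed_empty

lemma graphPtθ_one_eq (θ : ℝ) (u : ℝ × ℝ → ℝ) (p : ℝ × ℝ) :
    graphPtθ θ u p 1 = heightθ θ u p := graphPtθ_one θ u p

lemma continuousOn_graphPtθ (hu : ContDiffOn ℝ (⊤ : ℕ∞) u Ω) :
    ContinuousOn (graphPtθ θ u) Ω := by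
  have := hu.continuousOn
  unfold graphPtθ
  fun_prop

/-- The barrier `e^{-z} + z - (x² + y²)` as a function on `ℝ³`. -/
def barrier (q : E3) : ℝ := expBarrier (q 2) + -1 * (q 0 ^ 2 + q 1 ^ 2)

lemma barrier_graphPtθ (θ : ℝ) (u : ℝ × ℝ → ℝ) (p : ℝ × ℝ) :
    barrier (graphPtθ θ u p) = barrierθ θ u p := by
  simp only [barrier, barrierθ, graphPtθ_zero, graphPtθ_one, graphPtθ_two, heightθ, depthθ]

lemma continuous_barrier : Continuous barrier := by
  unfold barrier expBarrier
  fun_prop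

lemma image_subset_connectedComponentIn (hgraph : IsTranslatingGraph e1 (bθ θ) (vθ θ) Ω u S)
    {t : ℝ} {q : E3} {K : Set (ℝ × ℝ)} (hK : IsPreconnected K) (hKΩ : K ⊆ Ω)
    (hKt : ∀ p ∈ K, t ≤ heightθ θ u p) {p : ℝ × ℝ} (hp : p ∈ K)
    (hpq : graphPtθ θ u p ∈ connectedComponentIn (S ∩ {q : E3 | t ≤ q 1}) q) :
    graphPtθ θ u '' K ⊆ connectedComponentIn (S ∩ {q : E3 | t ≤ q 1}) q := by
  rw [connectedComponentIn_eq hpq]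
  refine (hK.image _ ((continuousOn_graphPtθ hgraph.smooth).mono hKΩ)).subset_connectedComponentIn
    (Set.mem_image_of_mem _ hp) ?_
  rintro _ ⟨y, hy, rfl⟩
  refine ⟨(mem_graph_iff hgraph).2 ⟨y, hKΩ hy, rfl⟩, ?_⟩
  simpa only [Set.mem_ofPred_eq, graphPtθ_one_eq] using hKt y hy

lemma isLocalMax_of_max_on_component (hgraph : IsTranslatingGraph e1 (bθ θ) (vθ θ) Ω u S)
    {t : ℝ} {q : E3} {G : E3 → ℝ} {p : ℝ × ℝ} (hp : p ∈ Ω) (hpt : t < heightθ θ u p)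
    (hpq : graphPtθ θ u p ∈ connectedComponentIn (S ∩ {q : E3 | t ≤ q 1}) q)
    (hmax : ∀ a ∈ connectedComponentIn (S ∩ {q : E3 | t ≤ q 1}) q, G a ≤ G (graphPtθ θ u p)) :
    IsLocalMax (fun y => G (graphPtθ θ u y)) p := by
  have hc := ((smooth_heightθ (θ := θ) hgraph.smooth).continuousOn).continuousAt
    (hgraph.isOpen_dom.mem_nhds hp)
  obtain ⟨ε, hε, hb⟩ := Metric.eventually_nhds_iff_ball.1
    ((hgraph.isOpen_dom.eventually_mem hp).and (hc.eventually (lt_mem_nhds hpt)))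
  have := image_subset_connectedComponentIn hgraph (convex_ball p ε).isPreconnected
    (fun y hy => (hb y hy).1) (fun y hy => (hb y hy).2.le) (mem_ball_self hε) hpq
  filter_upwards [ball_mem_nhds p hε] with y hy
  exact hmax _ (this (Set.mem_image_of_mem _ hy))

lemma isBounded_of_coord_bound {K : Set E3} {R : ℝ} (h : ∀ q ∈ K, ∀ i, |q i| ≤ R) :
    Bornology.IsBounded K := by
  refine (isBounded_iff_forall_norm_le).2 ⟨Real.sqrt (3 * R ^ 2), fun q hq => ?_⟩
  rw [EuclideanSpace.norm_eq]
  refine Real.sqrt_le_sqrt ?_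
  rw [Fin.sum_univ_three]
  have hi : ∀ i, ‖q i‖ ^ 2 ≤ R ^ 2 := fun i =>
    pow_le_pow_left₀ (norm_nonneg _) (h q hq i) 2
  linarith [hi 0, hi 1, hi 2]

lemma exists_high_point_of_lt (hgraph : IsTranslatingGraph e1 (bθ θ) (vθ θ) Ω u S)
    (hcomplete : IsClosed S) {w : ℝ} (hslab : S ⊆ {q : E3 | |q 0| ≤ w}) {t : ℝ} (t' : ℝ)
    {q q₀ : E3} (hq₀ : q₀ ∈ connectedComponentIn (S ∩ {q : E3 | t ≤ q 1}) q) (ht₀ : t < q₀ 1) :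
    ∃ a ∈ connectedComponentIn (S ∩ {q : E3 | t ≤ q 1}) q, t' ≤ a 1 := by
  by_contra! hlow
  set C := connectedComponentIn (S ∩ {q : E3 | t ≤ q 1}) q with hC
  have hCsub : C ⊆ S ∩ {q : E3 | t ≤ q 1} := connectedComponentIn_subset _ _
  have hCcl : IsClosed C := isClosed_connectedComponentIn
    (hcomplete.inter (isClosed_le continuous_const (by fun_prop))) q
  have hx : ∀ a ∈ C, a 0 ^ 2 ≤ w ^ 2 := fun a ha =>
    sq_le_sq' (neg_le_of_abs_le (hslab (hCsub ha).1)) (le_of_abs_le (hslab (hCsub ha).1))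
  have hy : ∀ a ∈ C, a 1 ^ 2 ≤ t ^ 2 + t' ^ 2 := fun a ha => by
    have h1 : t ≤ a 1 := (hCsub ha).2
    have h2 := hlow a ha
    rcases le_total 0 (a 1) with h | h <;> nlinarith [sq_nonneg t, sq_nonneg t']
  set D := w ^ 2 + (t ^ 2 + t' ^ 2) with hD
  have hBD : ∀ a ∈ C, expBarrier (a 2) ≤ barrier a + D := fun a ha => by
    have h1 := hx a ha
    have h2 := hy a ha
    unfold barrier
    linarith
  have hB₀ : 0 < barrier q₀ + D := zero_lt_one.trans_le ((one_le_expBarrier _).trans (hBD _ hq₀))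
  obtain ⟨ε, hε, hεt⟩ : ∃ ε > 0, t < q₀ 1 - ε * (barrier q₀ + D) :=
    ⟨(q₀ 1 - t) / (2 * (barrier q₀ + D)), by have := sub_pos.2 ht₀; positivity, by
      have : (q₀ 1 - t) / (2 * (barrier q₀ + D)) * (barrier q₀ + D) = (q₀ 1 - t) / 2 := by
        field_simp
      rw [this]
      linarith⟩
  set G : E3 → ℝ := fun a => a 1 + -ε * barrier a with hG
  have hGc : Continuous G := by
    have := continuous_barrier
    fun_prop
  set K := C ∩ {a | G q₀ ≤ G a} with hK
  have hKc : IsCompact K := by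
    refine Metric.isCompact_of_isClosed_isBounded
      (hCcl.inter (isClosed_le continuous_const hGc))
      (isBounded_of_coord_bound (R := |w| + (|t| + |t'|) + |(t' - G q₀) / ε + D|) ?_)
    rintro a ⟨ha, hGa⟩ i
    have h0 : |a 0| ≤ |w| := sq_le_sq.1 (hx a ha)
    have h1 : |a 1| ≤ |t| + |t'| := by
      have h1 : t ≤ a 1 := (hCsub ha).2
      have h2 := hlow a ha
      rw [abs_le]
      constructor <;> linarith [neg_abs_le t, le_abs_self t', abs_nonneg t, abs_nonneg t']
    have h2 : |a 2| ≤ |(t' - G q₀) / ε + D| := by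
      refine (abs_le_expBarrier _).trans ((hBD a ha).trans (le_trans ?_ (le_abs_self _)))
      gcongr
      rw [le_div_iff₀ hε]
      have hGa' : G q₀ ≤ a 1 + -ε * barrier a := hGa
      linarith [hlow a ha]
    have := abs_nonneg w
    have := abs_nonneg t
    have := abs_nonneg t'
    have := abs_nonneg ((t' - G q₀) / ε + D)
    fin_cases i <;> simp only [Fin.zero_eta, Fin.mk_one, Fin.reduceFinMk] <;> linarith
  obtain ⟨a, ⟨haC, haG⟩, hamax⟩ := hKc.exists_isMaxOn ⟨q₀, hq₀, le_refl (G q₀)⟩ hGc.continuousOn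
  have hamaxC : ∀ b ∈ C, G b ≤ G a := fun b hb => by
    rcases le_total (G q₀) (G b) with h | h
    · exact hamax ⟨hb, h⟩
    · exact h.trans haG
  obtain ⟨p, hp, rfl⟩ := (mem_graph_iff hgraph).1 (hCsub haC).1
  have hat : t < heightθ θ u p := by
    have h1 : q₀ 1 + -ε * barrier q₀ ≤ graphPtθ θ u p 1 + -ε * barrier (graphPtθ θ u p) := haG
    have h2 := (zero_le_one.trans (one_le_expBarrier _)).trans (hBD _ haC)
    rw [graphPtθ_one_eq] at h1
    nlinarith
  have hloc := isLocalMax_of_max_on_component hgraph hp hat haC hamaxC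
  have hfun : (fun y => G (graphPtθ θ u y)) = fun y => heightθ θ u y + -ε * barrierθ θ u y := by
    ext y
    simp only [hG, graphPtθ_one_eq, barrier_graphPtθ]
  rw [hfun] at hloc
  have hΩ := hgraph.isOpen_dom
  have hh := smooth_heightθ (θ := θ) hgraph.smooth
  have hb := smooth_barrierθ (θ := θ) hgraph.smooth
  have h1 := (ell_nonpos_of_isLocalMax hΩ (hh.add (contDiffOn_const.mul hb)) hp hloc
    (pds u p) (pdt u p) (Real.cos θ * (1 + pds u p ^ 2 + pdt u p ^ 2))).2.2
  rw [ell_add hΩ hh (contDiffOn_const.mul hb) hp, ell_const_mul hΩ hb hp,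
    ell_heightθ hgraph hp] at h1
  nlinarith [ell_barrierθ_neg hgraph hp]

lemma exists_higher_point (hgraph : IsTranslatingGraph e1 (bθ θ) (vθ θ) Ω u S)
    (hcomplete : IsClosed S) {w : ℝ} (hslab : S ⊆ {q : E3 | |q 0| ≤ w}) {t : ℝ}
    {q : E3} (hq : q ∈ S ∩ {q : E3 | t ≤ q 1}) :
    ∃ a ∈ connectedComponentIn (S ∩ {q : E3 | t ≤ q 1}) q, t < a 1 := by
  obtain ⟨p, hp, rfl⟩ := (mem_graph_iff hgraph).1 hq.1
  have hpt : t ≤ heightθ θ u p := by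
    rw [← graphPtθ_one_eq]
    exact hq.2
  obtain ⟨v, hv⟩ := exists_increasing_direction hgraph hcomplete hslab hp
  have hv' : ∀ᶠ s : ℝ in 𝓝[>] 0, p + s • v ∈ Ω ∧ heightθ θ u p < heightθ θ u (p + s • v) :=
    (((tendsto_line p v).eventually (hgraph.isOpen_dom.eventually_mem hp)).filter_mono
      nhdsWithin_le_nhds).and hv
  obtain ⟨δ, hδ, hs⟩ := mem_nhdsGT_iff_exists_Ioc_subset.1 hv'
  have hmem : ∀ s ∈ Set.Icc (0 : ℝ) δ, p + s • v ∈ Ω ∧ t ≤ heightθ θ u (p + s • v) := by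
    rintro s ⟨h0, h1⟩
    rcases h0.eq_or_lt with rfl | h0
    · simpa using ⟨hp, hpt⟩
    · exact ⟨(hs ⟨h0, h1⟩).1, hpt.trans (hs ⟨h0, h1⟩).2.le⟩
  have hsub := image_subset_connectedComponentIn hgraph (q := graphPtθ θ u p) (t := t) (p := p)
    (isPreconnected_Icc.image (fun s : ℝ => p + s • v) (by fun_prop))
    (Set.image_subset_iff.2 fun s hs => (hmem s hs).1)
    (Set.forall_mem_image.2 fun s hs => (hmem s hs).2)
    ⟨0, ⟨le_rfl, (Set.mem_Ioi.1 hδ).le⟩, by simp⟩ (mem_connectedComponentIn hq)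
  have hδ0 : (0 : ℝ) < δ := hδ
  refine ⟨graphPtθ θ u (p + δ • v), hsub ⟨_, ⟨δ, ⟨hδ0.le, le_rfl⟩, rfl⟩, rfl⟩, ?_⟩
  rw [graphPtθ_one_eq]
  exact hpt.trans_lt (hs ⟨hδ0, le_rfl⟩).2

lemma numComponents_le_of_forall_mem {A B : Set E3} (hAB : B ⊆ A)
    (h : ∀ q ∈ A, ∃ a ∈ connectedComponentIn A q, a ∈ B) : numComponents A ≤ numComponents B := by
  refine Cardinal.mk_le_of_surjective
    (f := (continuous_inclusion hAB).connectedComponentsMap) fun c => ?_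
  obtain ⟨⟨q, hq⟩, rfl⟩ := ConnectedComponents.surjective_coe c
  obtain ⟨a, ha, haB⟩ := h q hq
  rw [connectedComponentIn_eq_image hq] at ha
  obtain ⟨b, hb, rfl⟩ := ha
  exact ⟨((⟨b, haB⟩ : B) : ConnectedComponents B), ConnectedComponents.coe_eq_coe'.2 hb⟩

end Components

/-- monotonicity of the number of connected components of `Σ ∩ {y ≥ t}` in `t`,
for a complete connected translating graph in a direction `v_θ` contained in a slab. -/
theorem stmt6 (θ : ℝ) (hθ : θ ∈ Set.Ico 0 π) (Ω : Set (ℝ × ℝ)) (u : ℝ × ℝ → ℝ) (S : Set E3)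
    (hgraph : IsTranslatingGraph e1 (bθ θ) (vθ θ) Ω u S) (hcomplete : IsClosed S)
    (w : ℝ) (hw : 0 < w) (hslab : S ⊆ {q : E3 | |q 0| ≤ w}) :
    ∀ t t' : ℝ, t ≤ t' →
      numComponents (S ∩ {q : E3 | t ≤ q 1}) ≤ numComponents (S ∩ {q : E3 | t' ≤ q 1}) := by
  intro t t' htt
  refine numComponents_le_of_forall_mem (fun q hq => ⟨hq.1, htt.trans hq.2⟩) fun q hq => ?_
  obtain ⟨q₀, hq₀, ht₀⟩ := exists_higher_point hgraph hcomplete hslab hq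
  obtain ⟨a, ha, hat⟩ := exists_high_point_of_lt hgraph hcomplete hslab t' hq₀ ht₀
  exact ⟨a, ha, (connectedComponentIn_subset _ _ ha).1, hat⟩
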